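/- arXiv:1811.11444 — 2 statements merged into one kernel-verified Lean document; each statement's English description precedes it below -/
import Mathlib

section
/- Let α = (1+√5)/2. Then limsup_{n→∞} (max_{i≥1} D(2,i,n))/n = α/2 = (1+√5)/4 and liminf_{n→∞} (max_{i≥1} D(2,i,n))/n = (3α+2)/(4α+3), where D(2,i,n) is the number of distinct squares in F[i;n]. -/
/-- Fibonacci numbers: `fn 0 = 1`, `fn 1 = 2`, `fn (m+2) = fn (m+1) + fn m`
(so `fn m` is the paper's `f_m`; also `f_{m-1} = Nat.fib (m+1)` etc.). -/
def fn (m : ℕ) : ℕ := Nat.fib (m + 2)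

/-- Finite Fibonacci words `Fw m = σ^m(a)` for the morphism σ(a)=ab, σ(b)=a,
with `a := false`, `b := true`; equivalently `Fw (m+2) = Fw (m+1) ++ Fw m`. -/
def Fw : ℕ → List Bool
  | 0 => [false]
  | 1 => [false, true]
  | m + 2 => Fw (m + 1) ++ Fw m

/-- The infinite Fibonacci word (0-indexed): the fixed point of σ beginning with `a`. -/
def fibWord (i : ℕ) : Bool := (Fw (i + 1)).getD i false

/-- `fFactor i n = F[i;n]`, the factor of length `n` of the Fibonacci word
beginning at (1-indexed) position `i`. -/
def fFactor (i n : ℕ) : List Bool := (List.range n).map fun t => fibWord (i - 1 + t)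

/-- `w` occurs as a factor of the infinite Fibonacci word. -/
def IsFactorF (w : List Bool) : Prop := ∃ i : ℕ, 1 ≤ i ∧ w = fFactor i w.length

/-- `D2 i n`: the number of distinct squares occurring as factors of `F[i;n]`. -/
noncomputable def D2 (i n : ℕ) : ℕ :=
  {w : List Bool | w ≠ [] ∧ (w ++ w) <:+: fFactor i n}.ncard

/-- The maximum over `i ≥ 1` of the number of distinct squares in `F[i;n]`. -/
noncomputable def maxD2 (n : ℕ) : ℕ := sSup {d : ℕ | ∃ i, 1 ≤ i ∧ D2 i n = d}

open Nat (fib)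

lemma Fw_length : ∀ m, (Fw m).length = fib (m + 2)
  | 0 => by simp [Fw]
  | 1 => by simp [Fw, Nat.fib_add_two]
  | m + 2 => by
    rw [Fw, List.length_append, Fw_length (m + 1), Fw_length m, Nat.fib_add_two (n := m + 2)]
    exact add_comm _ _

lemma lt_fib_add_three (i : ℕ) : i < fib (i + 3) := by
  induction i with
  | zero => simp [Nat.fib_add_two]
  | succ i ih =>
    have h1 := Nat.fib_add_two (n := i + 2)
    have h2 : 0 < fib (i + 2) := Nat.fib_pos.2 (by omega)
    have e : i + 1 + 3 = i + 2 + 2 := by omega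
    have e' : i + 2 + 1 = i + 3 := by omega
    rw [e, h1, e']
    omega

lemma Fw_succ_getD (m i : ℕ) (h : i < fib (m + 2)) :
    (Fw (m + 1)).getD i false = (Fw m).getD i false := by
  cases m with
  | zero =>
    have : i = 0 := by simpa using h
    subst this; rfl
  | succ m =>
    rw [Fw, List.getD_append _ _ _ _ (by rw [Fw_length]; exact h)]

lemma Fw_add_getD (d m i : ℕ) (h : i < fib (m + 2)) :
    (Fw (m + d)).getD i false = (Fw m).getD i false := by
  induction d with
  | zero => rfl
  | succ d ih =>
    rw [← ih, ← add_assoc, Fw_succ_getD]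
    exact lt_of_lt_of_le h (Nat.fib_mono (by omega))

lemma Fw_getD (m i : ℕ) (h : i < fib (m + 2)) : (Fw m).getD i false = fibWord i := by
  unfold fibWord
  rw [← Fw_add_getD (i + 1) m i h, ← Fw_add_getD m (i + 1) i (lt_fib_add_three i), add_comm]

/-- the basic recurrence -/
lemma F_rec (n s : ℕ) (h : s < fib (n + 2)) : fibWord (fib (n + 3) + s) = fibWord s := by
  have h1 := Nat.fib_add_two (n := n + 2)
  have h2 : fib (n + 2 + 1) = fib (n + 3) := rfl
  rw [← Fw_getD (n + 2) _ (by omega), Fw, List.getD_append_right _ _ _ _ (by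
      rw [Fw_length, show n + 1 + 2 = n + 3 from rfl]; omega), Fw_length]
  have : fib (n + 3) + s - fib (n + 1 + 2) = s := by
    have : fib (n + 1 + 2) = fib (n + 3) := rfl
    omega
  rw [this, Fw_getD _ _ h]

lemma F_zero : fibWord 0 = false := rfl
lemma F_one : fibWord 1 = true := rfl

/-- last letters alternate -/
lemma F_last (n : ℕ) : fibWord (fib (n + 2) - 1) ≠ fibWord (fib (n + 3) - 1) := by
  induction n with
  | zero => decide
  | succ n ih =>
    have h1 := Nat.fib_add_two (n := n + 2)
    have h2 : fib (n + 2 + 1) = fib (n + 3) := rfl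
    have h3 : 0 < fib (n + 2) := Nat.fib_pos.2 (by omega)
    have h4 := F_rec n (fib (n + 2) - 1) (by omega)
    have h5 : fib (n + 3) + (fib (n + 2) - 1) = fib (n + 1 + 3) - 1 := by
      have : fib (n + 1 + 3) = fib (n + 2 + 2) := rfl
      omega
    rw [h5] at h4
    rw [h4]
    exact ih.symm

/-- near commutation -/
lemma F_near (n y : ℕ) (h : y + 2 < fib (n + 4)) : fibWord (fib (n + 3) + y) = fibWord y := by
  induction n generalizing y with
  | zero =>
    have : y = 0 := by simp [Nat.fib_add_two] at h; omega
    subst this; rfl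
  | succ n ih =>
    have h1 := Nat.fib_add_two (n := n + 3)
    have h1' : fib (n + 3 + 2) = fib (n + 1 + 4) := rfl
    have h2 : fib (n + 3 + 1) = fib (n + 1 + 3) := rfl
    have h3 := Nat.fib_add_two (n := n + 4)
    have h4 : fib (n + 4 + 1) = fib (n + 3 + 2) := rfl
    by_cases hy : y < fib (n + 3)
    · exact F_rec (n + 1) y hy
    · obtain ⟨z, rfl⟩ := Nat.exists_eq_add_of_le (not_lt.1 hy)
      rw [ih z (by have : fib (n + 4) = fib (n + 1 + 3) := rfl
                   omega)]
      have h5 : fib (n + 1 + 3) + (fib (n + 3) + z) = fib (n + 2 + 3) + z := by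
        have : fib (n + 2 + 3) = fib (n + 3 + 2) := rfl
        omega
      rw [h5]
      exact F_rec (n + 2) z (by have : fib (n + 2 + 2) = fib (n + 1 + 3) := rfl
                                omega)

/-- block lengths -/
def bl (k : ℕ) (b : Bool) : ℕ := if b then fib (k + 1) else fib (k + 2)

/-- positions of the cuts of level `k`. -/
def cut (k : ℕ) : ℕ → ℕ
  | 0 => 0
  | i + 1 => cut k i + bl k (fibWord i)

lemma bl_pos (k : ℕ) (b : Bool) : 0 < bl k b := by
  unfold bl; split_ifs <;> exact Nat.fib_pos.2 (by omega)

lemma bl_ge (k : ℕ) (b : Bool) : fib (k + 1) ≤ bl k b := by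
  unfold bl; split_ifs
  · exact le_rfl
  · exact Nat.fib_mono (by omega)

lemma bl_le (k : ℕ) (b : Bool) : bl k b ≤ fib (k + 2) := by
  unfold bl; split_ifs
  · exact Nat.fib_mono (by omega)
  · exact le_rfl

lemma cut_succ (k i : ℕ) : cut k (i + 1) = cut k i + bl k (fibWord i) := rfl
lemma cut_succ_a {k i : ℕ} (h : fibWord i = false) : cut k (i + 1) = cut k i + fib (k + 2) := by
  rw [cut_succ, h]; rfl
lemma cut_succ_b {k i : ℕ} (h : fibWord i = true) : cut k (i + 1) = cut k i + fib (k + 1) := by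
  rw [cut_succ, h]; rfl

lemma cut_strictMono (k : ℕ) : StrictMono (cut k) :=
  strictMono_nat_of_lt_succ fun i => by rw [cut_succ]; have := bl_pos k (fibWord i); omega

lemma cut_zero_level (i : ℕ) : cut 0 i = i := by
  induction i with
  | zero => rfl
  | succ i ih => rw [cut_succ, ih]; unfold bl; split_ifs <;> simp

lemma exists_cut (k j : ℕ) : ∃ u r, j = cut k u + r ∧ r < bl k (fibWord u) := by
  induction j with
  | zero => exact ⟨0, 0, rfl, bl_pos _ _⟩
  | succ j ih =>
    obtain ⟨u, r, h, hr⟩ := ih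
    by_cases h' : r + 1 < bl k (fibWord u)
    · exact ⟨u, r + 1, by omega, h'⟩
    · refine ⟨u + 1, 0, ?_, bl_pos _ _⟩
      rw [cut_succ]; omega

lemma cut_one_fib_add (n : ℕ) : cut 1 (fib (n + 2)) = fib (n + 3) ∧
    ∀ s ≤ fib (n + 2), cut 1 (fib (n + 3) + s) = cut 1 (fib (n + 3)) + cut 1 s := by
  have key : ∀ n, ∀ s ≤ fib (n + 2), cut 1 (fib (n + 3) + s) = cut 1 (fib (n + 3)) + cut 1 s := by
    intro n s
    induction s with
    | zero => intro _; rfl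
    | succ s ih =>
      intro hs
      rw [← add_assoc, cut_succ, cut_succ, ih (by omega), F_rec n s (by omega)]
      omega
  refine ⟨?_, key n⟩
  induction n using Nat.strong_induction_on with
  | _ n ih =>
    match n with
    | 0 => rfl
    | 1 => rfl
    | n + 2 =>
      have e : fib (n + 2 + 2) = fib (n + 3) + fib (n + 2) := by
        rw [Nat.fib_add_two (n := n + 2), add_comm]
      have e2 : fib (n + 2 + 3) = fib (n + 4) + fib (n + 3) := by
        rw [Nat.fib_add_two (n := n + 3), add_comm]
      rw [e, key n _ le_rfl, ih n (by omega), e2]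
      congr 1
      exact ih (n + 1) (by omega)

/-- `F = σ(F)`. -/
lemma F_sigma (i : ℕ) : fibWord (cut 1 i) = false ∧
    (fibWord i = false → fibWord (cut 1 i + 1) = true) := by
  induction i using Nat.strong_induction_on with
  | _ i ih =>
    by_cases hi : i < 2
    · interval_cases i
      · exact ⟨rfl, fun _ => rfl⟩
      · refine ⟨rfl, fun h => ?_⟩
        rw [F_one] at h; cases h
    · obtain ⟨n, hn, hn'⟩ : ∃ n, fib (n + 3) ≤ i ∧ i < fib (n + 4) := by
        have hex : ∃ m, i < fib (m + 4) :=
          ⟨i, lt_of_lt_of_le (lt_fib_add_three i) (Nat.fib_mono (by omega))⟩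
        classical
        refine ⟨Nat.find hex, ?_, Nat.find_spec hex⟩
        rcases h : Nat.find hex with _ | m
        · simp [Nat.fib_add_two]; omega
        · have := Nat.find_min hex (m := m) (by omega)
          exact not_lt.1 this
      obtain ⟨s, rfl⟩ := Nat.exists_eq_add_of_le hn
      have h1 := Nat.fib_add_two (n := n + 2)
      have h1a : fib (n + 2 + 2) = fib (n + 4) := rfl
      have h1b : fib (n + 2 + 1) = fib (n + 3) := rfl
      have hs : s < fib (n + 2) := by omega
      have h2 := (cut_one_fib_add n).2 s hs.le
      have h3 : cut 1 (fib (n + 3)) = fib (n + 4) := (cut_one_fib_add (n + 1)).1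
      have h4 : cut 1 (s + 1) ≤ fib (n + 3) := by
        rw [← (cut_one_fib_add n).1]
        exact (cut_strictMono 1).monotone hs
      have h5 := ih s (by have : 0 < fib (n + 3) := Nat.fib_pos.2 (by omega)
                          omega)
      have h6 := cut_succ 1 s
      have h7 := bl_pos 1 (fibWord s)
      rw [h2, h3]
      constructor
      · rw [show fib (n + 4) = fib (n + 1 + 3) from rfl,
          F_rec (n + 1) _ (by rw [show n + 1 + 2 = n + 3 from rfl]; omega)]
        exact h5.1
      · intro h
        rw [F_rec n s hs] at h
        have h8 := cut_succ_a (k := 1) h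
        have h9 : fib (1 + 2) = 2 := rfl
        rw [add_assoc, show fib (n + 4) = fib (n + 1 + 3) from rfl,
          F_rec (n + 1) _ (by rw [show n + 1 + 2 = n + 3 from rfl]; omega)]
        exact h5.2 h

lemma cut_level_succ (k i : ℕ) : cut (k + 1) i = cut k (cut 1 i) := by
  induction i with
  | zero => rfl
  | succ i ih =>
    have h := F_sigma i
    cases hi : fibWord i with
    | false =>
      rw [cut_succ_a hi, cut_succ_a hi, ih]
      have e : cut 1 i + fib (1 + 2) = cut 1 i + 1 + 1 := rfl
      rw [e, cut_succ_b (h.2 hi), cut_succ_a h.1]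
      have := Nat.fib_add_two (n := k + 1)
      have h2 : fib (k + 1 + 1) = fib (k + 2) := rfl
      omega
    | true =>
      rw [cut_succ_b hi, cut_succ_b hi, ih]
      have e : cut 1 i + fib (1 + 1) = cut 1 i + 1 := rfl
      rw [e, cut_succ_a h.1]

/-- blocks of level `k+1` are prefixes. -/
lemma F_block (k u s : ℕ) (h : s < bl (k + 1) (fibWord u)) :
    fibWord (cut (k + 1) u + s) = fibWord s := by
  induction k generalizing u s with
  | zero =>
    have h' := F_sigma u
    cases hu : fibWord u with
    | false =>
      rw [hu] at h
      have : s < 2 := h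
      interval_cases s
      · exact h'.1
      · exact h'.2 hu
    | true =>
      rw [hu] at h
      have : s < 1 := h
      interval_cases s
      exact h'.1
  | succ k ih =>
    have h' := F_sigma u
    rw [cut_level_succ (k + 1)]
    have ha : ∀ s < fib (k + 3), fibWord (cut (k + 1) (cut 1 u) + s) = fibWord s := by
      intro s hs
      apply ih; rw [h'.1]; exact hs
    cases hu : fibWord u with
    | true => rw [hu] at h; exact ha s h
    | false =>
      rw [hu] at h
      by_cases hs : s < fib (k + 3)
      · exact ha s hs
      · obtain ⟨z, rfl⟩ := Nat.exists_eq_add_of_le (not_lt.1 hs)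
        have h1 := Nat.fib_add_two (n := k + 2)
        have h1a : fib (k + 2 + 1) = fib (k + 3) := rfl
        have h2 : bl (k + 1 + 1) false = fib (k + 2 + 2) := rfl
        have e := cut_succ_a (k := k + 1) h'.1
        rw [← add_assoc, show fib (k + 3) = fib (k + 1 + 2) from rfl, ← e, ih]
        · exact (F_rec k z (by omega)).symm
        · rw [h'.2 hu]; show z < fib (k + 2); omega

lemma no_bb (j : ℕ) (h : fibWord j = true) : fibWord (j + 1) = false := by
  obtain ⟨u, r, rfl, hr⟩ := exists_cut 1 j
  have h' := F_sigma u
  cases hu : fibWord u with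
  | true =>
    rw [hu] at hr
    have : r < 1 := hr
    interval_cases r
    rw [add_zero, h'.1] at h; cases h
  | false =>
    rw [hu] at hr
    have : r < 2 := hr
    interval_cases r
    · rw [add_zero, h'.1] at h; cases h
    · have := cut_succ_a (k := 1) hu
      have e : cut 1 u + 1 + 1 = cut 1 (u + 1) := by rw [this]; rfl
      rw [e]; exact (F_sigma (u + 1)).1

lemma a_is_cut (j : ℕ) (h : fibWord j = false) : ∃ u, j = cut 1 u := by
  obtain ⟨u, r, rfl, hr⟩ := exists_cut 1 j
  have h' := F_sigma u
  have hr2 : r < 2 := lt_of_lt_of_le hr (bl_le 1 _)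
  interval_cases r
  · exact ⟨u, rfl⟩
  · cases hu : fibWord u with
    | true => rw [hu] at hr; have : 1 < 1 := hr; omega
    | false => rw [h'.2 hu] at h; cases h

lemma cut_one_next_a (u : ℕ) (h : fibWord (cut 1 u + 1) = false) :
    fibWord u = true ∧ cut 1 u + 1 = cut 1 (u + 1) := by
  cases hu : fibWord u with
  | false => rw [(F_sigma u).2 hu] at h; cases h
  | true => exact ⟨rfl, (cut_succ_b hu).symm⟩

lemma cut_one_next_b (u : ℕ) (h : fibWord (cut 1 u + 1) = true) :
    fibWord u = false ∧ cut 1 u + 2 = cut 1 (u + 1) := by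
  cases hu : fibWord u with
  | false => exact ⟨rfl, (cut_succ_a hu).symm⟩
  | true =>
    have := cut_succ_b (k := 1) hu
    have e : cut 1 u + 1 = cut 1 (u + 1) := by rw [this]; rfl
    rw [e, (F_sigma _).1] at h; cases h

lemma no_aaa (j : ℕ) (h : fibWord j = false) (h1 : fibWord (j + 1) = false) :
    fibWord (j + 2) = true := by
  by_contra h2
  rw [Bool.not_eq_true] at h2
  obtain ⟨u, rfl⟩ := a_is_cut j h
  obtain ⟨hu, e⟩ := cut_one_next_a u h1
  have h3 : fibWord (cut 1 (u + 1) + 1) = false := by rw [← e]; exact h2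
  have := (cut_one_next_a _ h3).1
  rw [no_bb u hu] at this; cases this

lemma no_ababab (j : ℕ) (h : fibWord j = false) (h1 : fibWord (j + 1) = true)
    (h3 : fibWord (j + 3) = true) : fibWord (j + 5) = false := by
  by_contra h5
  rw [Bool.not_eq_false] at h5
  obtain ⟨u, rfl⟩ := a_is_cut j h
  obtain ⟨hu, e⟩ := cut_one_next_b u h1
  obtain ⟨hu1, e1⟩ := cut_one_next_b (u + 1) (by rw [← e]; exact h3)
  obtain ⟨hu2, e2⟩ := cut_one_next_b (u + 1 + 1) (by rw [← e1, ← e]; exact h5)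
  have := no_aaa u hu hu1
  rw [show u + 2 = u + 1 + 1 from rfl, hu2] at this; cases this
/-- a square of period `p` at position `j` (0-indexed). -/
def SqAt (j p : ℕ) : Prop := ∀ t < p, fibWord (j + t) = fibWord (j + p + t)

lemma fib_s (n : ℕ) : fib (n + 2) = fib n + fib (n + 1) := Nat.fib_add_two
lemma fib_s2 (n : ℕ) : fib (n + 3) = fib (n + 1) + fib (n + 2) := Nat.fib_add_two
lemma fib_s3 (n : ℕ) : fib (n + 4) = fib (n + 2) + fib (n + 3) := Nat.fib_add_two
lemma fib_s4 (n : ℕ) : fib (n + 5) = fib (n + 3) + fib (n + 4) := Nat.fib_add_two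
lemma fib_p1 (n : ℕ) : 0 < fib (n + 1) := Nat.fib_pos.2 (by omega)
lemma fib_le1 (n : ℕ) : fib (n + 1) ≤ fib (n + 2) := Nat.fib_mono (by omega)

lemma F_block_a {k u s : ℕ} (hu : fibWord u = false) (h : s < fib (k + 4)) :
    fibWord (cut (k + 1) u + s) = fibWord s := by
  have h1 := fib_s3 k
  by_cases hs : s < fib (k + 3)
  · apply F_block; rw [hu]; exact hs
  · obtain ⟨z, rfl⟩ := Nat.exists_eq_add_of_le (not_lt.1 hs)
    have e := cut_succ_a (k := k + 1) hu
    rw [← add_assoc, show fib (k + 3) = fib (k + 1 + 2) from rfl, ← e, F_block]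
    · exact (F_rec k z (by omega)).symm
    · exact lt_of_lt_of_le (by omega : z < fib (k + 2)) (bl_ge (k + 1) _)

lemma F_type_b {k u : ℕ} (hu : fibWord u = true) :
    fibWord (cut (k + 1) u + (fib (k + 4) - 1)) = fibWord (fib (k + 3) - 1) := by
  have h1 := fib_s3 k
  have h2 := fib_p1 (k + 2)
  have e := cut_succ_b (k := k + 1) hu
  have : cut (k + 1) u + (fib (k + 4) - 1) = cut (k + 1) (u + 1) + (fib (k + 3) - 1) := by
    rw [e, show k + 1 + 1 = k + 2 from rfl]
    rw [show k + 2 + 1 = k + 3 from rfl] at h2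
    omega
  rw [this, F_block]
  rw [no_bb u hu]
  show _ < fib (k + 3)
  rw [show k + 2 + 1 = k + 3 from rfl] at h2
  omega

lemma F_type_a {k u : ℕ} (hu : fibWord u = false) :
    fibWord (cut (k + 1) u + (fib (k + 4) - 1)) = fibWord (fib (k + 4) - 1) :=
  F_block_a hu (by have := fib_p1 (k + 3)
                   rw [show k + 3 + 1 = k + 4 from rfl] at this
                   omega)

lemma F_type {k u v : ℕ} (h : fibWord (cut (k + 1) u + (fib (k + 4) - 1)) =
    fibWord (cut (k + 1) v + (fib (k + 4) - 1))) : fibWord u = fibWord v := by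
  have h1 : fibWord (fib (k + 3) - 1) ≠ fibWord (fib (k + 4) - 1) := F_last (k + 1)
  cases hu : fibWord u <;> cases hv : fibWord v
  · rfl
  · rw [F_type_a hu, F_type_b hv] at h; exact absurd h.symm h1
  · rw [F_type_b hu, F_type_a hv] at h; exact absurd h h1
  · rfl

lemma F_prev {k u v : ℕ} (h : fibWord (cut (k + 1) (u + 1) - 1) =
    fibWord (cut (k + 1) (v + 1) - 1)) : fibWord u = fibWord v := by
  have h1 : fibWord (fib (k + 2) - 1) ≠ fibWord (fib (k + 3) - 1) := F_last k
  have key : ∀ u, fibWord (cut (k + 1) (u + 1) - 1) = fibWord (bl (k + 1) (fibWord u) - 1) := by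
    intro u
    have h2 := bl_pos (k + 1) (fibWord u)
    rw [cut_succ, Nat.add_sub_assoc h2]
    apply F_block
    omega
  rw [key, key] at h
  cases hu : fibWord u <;> cases hv : fibWord v <;> rw [hu, hv] at h
  · exact absurd h.symm h1
  · exact absurd h h1

lemma type_agree {j p k u v : ℕ} (hsq : SqAt j p) (h1 : j ≤ cut k u)
    (h2 : cut k u + fib (k + 3) ≤ j + p) (h3 : cut k u + p = cut k v) :
    fibWord u = fibWord v := by
  cases k with
  | zero =>
    simp only [cut_zero_level] at *
    have h4 := fib_p1 2
    rw [show 2 + 1 = 0 + 3 from rfl] at h4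
    have := hsq (u - j) (by omega)
    rwa [show j + (u - j) = u by omega, show j + p + (u - j) = v by omega] at this
  | succ k =>
    apply F_type (k := k)
    rw [show k + 1 + 3 = k + 4 from rfl] at h2
    have h4 := fib_p1 (k + 3)
    rw [show k + 3 + 1 = k + 4 from rfl] at h4
    have := hsq (cut (k + 1) u + (fib (k + 4) - 1) - j) (by omega)
    rwa [show j + (cut (k + 1) u + (fib (k + 4) - 1) - j) = cut (k + 1) u + (fib (k + 4) - 1) by omega,
      show j + p + (cut (k + 1) u + (fib (k + 4) - 1) - j) = cut (k + 1) v + (fib (k + 4) - 1) by omega]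
      at this

lemma prev_agree {j p k u v : ℕ} (hsq : SqAt j p) (h1 : j < cut k (u + 1))
    (h2 : cut k (u + 1) ≤ j + p) (h3 : cut k (u + 1) + p = cut k (v + 1)) :
    fibWord u = fibWord v := by
  have := hsq (cut k (u + 1) - 1 - j) (by omega)
  rw [show j + (cut k (u + 1) - 1 - j) = cut k (u + 1) - 1 by omega,
      show j + p + (cut k (u + 1) - 1 - j) = cut k (v + 1) - 1 by omega] at this
  cases k with
  | zero => simpa only [cut_zero_level, Nat.add_sub_cancel] using this
  | succ k => exact F_prev this

lemma sync {j p : ℕ} (hsq : SqAt j p) : ∀ k u, j ≤ cut k u → cut k u + fib (k + 2) ≤ j + p →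
    ∃ v, cut k u + p = cut k v := by
  intro k
  induction k with
  | zero => intro u _ _; exact ⟨u + p, by simp only [cut_zero_level]⟩
  | succ k ih =>
    intro u h1 h2
    rw [cut_level_succ] at h1 h2 ⊢
    rw [show k + 1 + 2 = k + 3 from rfl] at h2
    obtain ⟨v, hv⟩ := ih (cut 1 u) h1 (by
      have := fib_le1 (k + 1)
      rw [show k + 1 + 1 = k + 2 from rfl, show k + 1 + 2 = k + 3 from rfl] at this
      omega)
    have h3 := type_agree hsq h1 h2 hv
    rw [(F_sigma u).1] at h3
    obtain ⟨v', rfl⟩ := a_is_cut v h3.symm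
    exact ⟨v', by rw [hv, cut_level_succ k]⟩

lemma no_babab (j : ℕ) (h : fibWord j = true) (h2 : fibWord (j + 2) = true)
    (h4 : fibWord (j + 4) = true) : False := by
  cases j with
  | zero => rw [F_zero] at h; cases h
  | succ i =>
    have h0 : fibWord i = false := by
      by_contra hh
      rw [Bool.not_eq_false] at hh
      rw [no_bb i hh] at h; cases h
    have := no_ababab i h0 h h2
    rw [show i + 5 = i + 1 + 4 from rfl, h4] at this; cases this

lemma first_cut (k j : ℕ) : ∃ u, j ≤ cut k u ∧ cut k u < j + fib (k + 2) ∧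
    (j < cut k u → ∃ u', u = u' + 1 ∧ cut k u' < j) := by
  obtain ⟨u, r, h, hr⟩ := exists_cut k j
  rcases Nat.eq_zero_or_pos r with h0 | h0
  · refine ⟨u, by omega, ?_, by omega⟩
    have := fib_p1 (k + 1)
    rw [show k + 1 + 1 = k + 2 from rfl] at this
    omega
  · have h1 := cut_succ k u
    have h2 := bl_le k (fibWord u)
    exact ⟨u + 1, by omega, by omega, fun _ => ⟨u, rfl, by omega⟩⟩

lemma cut_three (k u : ℕ) : cut k (u + 3) ≤ cut k u + 2 * fib (k + 2) + fib (k + 1) := by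
  have h1 := fib_le1 k
  have e3 : cut k (u + 3) = cut k u + bl k (fibWord u) + bl k (fibWord (u + 1)) +
    bl k (fibWord (u + 2)) := rfl
  have ha : bl k false = fib (k + 2) := rfl
  have hb : bl k true = fib (k + 1) := rfl
  rw [e3]
  have := no_aaa u
  cases h0 : fibWord u <;> cases h1 : fibWord (u + 1) <;> cases h2 : fibWord (u + 2) <;>
    simp_all <;> omega

lemma cut_five (k u : ℕ) : cut k u + 3 * fib (k + 2) + 2 * fib (k + 1) ≤ cut k (u + 5) := by
  have h1 := fib_le1 k
  have e3 : cut k (u + 5) = cut k u + bl k (fibWord u) + bl k (fibWord (u + 1)) +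
    bl k (fibWord (u + 2)) + bl k (fibWord (u + 3)) + bl k (fibWord (u + 4)) := rfl
  have ha : bl k false = fib (k + 2) := rfl
  have hb : bl k true = fib (k + 1) := rfl
  rw [e3]
  have a0 := no_bb u
  have a1 := no_bb (u + 1)
  have a2 := no_bb (u + 2)
  have a3 := no_bb (u + 3)
  have a4 := no_babab u
  simp only [add_assoc, Nat.reduceAdd] at a1 a2 a3 a4
  cases h0 : fibWord u <;> cases h1 : fibWord (u + 1) <;> cases h2 : fibWord (u + 2) <;>
    cases h3 : fibWord (u + 3) <;> cases h4 : fibWord (u + 4) <;>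
    simp_all <;> omega

lemma not_between {j p k : ℕ} (hsq : SqAt j p) (h1 : fib (k + 4) < p) (h2 : p < fib (k + 5)) :
    False := by
  have f2 := fib_s k
  have f3 := fib_s2 k
  have f4 := fib_s3 k
  have f5 := fib_s4 k
  have fp := fib_p1 k
  have fl := fib_le1 k
  obtain ⟨u, hu1, hu2, hu3⟩ := first_cut k j
  obtain ⟨v, hv⟩ := sync hsq k u hu1 (by omega)
  have hd : v = u + 4 := by
    have m := (cut_strictMono k).monotone
    by_contra hne
    rcases Nat.lt_or_gt_of_ne hne with h | h
    · have := m (show v ≤ u + 3 by omega)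
      have := cut_three k u
      omega
    · have := m (show u + 5 ≤ v by omega)
      have := cut_five k u
      omega
  subst hd
  have t0 := type_agree hsq hu1 (by omega) hv
  have hnext : cut k (u + 1) + p = cut k (u + 4 + 1) := by
    rw [cut_succ, cut_succ, ← hv, t0]; omega
  have e1 := cut_succ k u
  have m1 : cut k u + bl k (fibWord u) + fib (k + 3) ≤ j + p →
      fibWord (u + 1) = fibWord (u + 4 + 1) := by
    intro h
    rw [← e1] at h
    exact type_agree hsq (by omega) h hnext
  have e4 : cut k (u + 4) = cut k u + bl k (fibWord u) + bl k (fibWord (u + 1)) +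
    bl k (fibWord (u + 2)) + bl k (fibWord (u + 3)) := rfl
  have ha : bl k false = fib (k + 2) := rfl
  have hb : bl k true = fib (k + 1) := rfl
  have a0 := no_bb u
  have a1 := no_bb (u + 1)
  have a2 := no_bb (u + 2)
  have a3 := no_bb (u + 3)
  have a5 := no_babab u
  have c0 := no_aaa u
  have c1 := no_aaa (u + 1)
  have c2 := no_aaa (u + 2)
  have c3 := no_aaa (u + 3)
  have d0 := no_ababab u
  simp only [add_assoc, Nat.reduceAdd] at a1 a2 a3 a5 c1 c2 c3 m1
  -- the case of `abab`
  have hprev : cut k u > j + fib (k + 1) → fibWord (u + 3) = true → False := by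
    intro h hb3
    obtain ⟨u', rfl, hu'⟩ := hu3 (by omega)
    have := prev_agree (u := u') (v := u' + 1 + 3) hsq (by omega) (by omega) hv
    rw [hb3] at this
    have e := cut_succ_b (k := k) this
    omega
  have hp : p = bl k (fibWord u) + bl k (fibWord (u + 1)) +
    bl k (fibWord (u + 2)) + bl k (fibWord (u + 3)) := by omega
  clear hu3 hv hnext e1 e4 hsq
  cases x0 : fibWord u <;> cases x1 : fibWord (u + 1) <;> cases x2 : fibWord (u + 2) <;>
    cases x3 : fibWord (u + 3) <;> cases x5 : fibWord (u + 5) <;>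
    simp_all <;> omega

lemma mismatch (k u : ℕ) : fibWord (cut (k + 2) u + (fib (k + 3) - 1)) ≠
    fibWord (cut (k + 2) u + (fib (k + 3) - 1) + fib (k + 2)) := by
  have h1 : fibWord (fib (k + 2) - 1) ≠ fibWord (fib (k + 3) - 1) := F_last k
  have h2 : fibWord (fib (k + 3) - 1) ≠ fibWord (fib (k + 4) - 1) := F_last (k + 1)
  have f3 := fib_s2 k
  have f4 := fib_s3 k
  have fp := fib_p1 (k + 2)
  have fp' := fib_p1 (k + 1)
  rw [show k + 2 + 1 = k + 3 from rfl] at fp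
  rw [show k + 1 + 1 = k + 2 from rfl] at fp'
  rw [F_block (k + 1) u (fib (k + 3) - 1)
    (lt_of_lt_of_le (by omega : _ < fib (k + 3)) (bl_ge (k + 2) _))]
  cases hu : fibWord u with
  | false =>
    have : cut (k + 2) u + (fib (k + 3) - 1) + fib (k + 2) = cut (k + 2) u + (fib (k + 4) - 1) := by
      omega
    rw [this, F_block (k + 1)]
    · exact h2
    · rw [hu]; show _ < fib (k + 4); omega
  | true =>
    have e := cut_succ_b (k := k + 2) hu
    rw [show k + 2 + 1 = k + 3 from rfl] at e
    have : cut (k + 2) u + (fib (k + 3) - 1) + fib (k + 2) =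
        cut (k + 2) (u + 1) + (fib (k + 2) - 1) := by
      omega
    rw [this, F_block (k + 1)]
    · exact h1.symm
    · exact lt_of_lt_of_le (by omega : _ < fib (k + 3)) (bl_ge (k + 2) _)
/-- the word of length `p` at position `j` -/
def wd (j p : ℕ) : List Bool := (List.range p).map fun t => fibWord (j + t)

lemma wd_length (j p : ℕ) : (wd j p).length = p := by simp [wd]

lemma wd_eq_iff {j j' p : ℕ} : wd j p = wd j' p ↔ ∀ t < p, fibWord (j + t) = fibWord (j' + t) := by
  simp [wd]

lemma wd_add (j a b : ℕ) : wd j (a + b) = wd j a ++ wd (j + a) b := by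
  simp [wd, List.range_add, add_assoc]

lemma sqAt_iff {j p : ℕ} : SqAt j p ↔ wd j p = wd (j + p) p := wd_eq_iff.symm

lemma infix_iff (w : List Bool) (i n : ℕ) : (w ++ w) <:+: wd i n ↔
    ∃ j, i ≤ j ∧ j + 2 * w.length ≤ i + n ∧ SqAt j w.length ∧ wd j w.length = w := by
  constructor
  · rintro ⟨s, t, h⟩
    have hl := congrArg List.length h
    simp only [List.length_append, wd_length] at hl
    have hn : n = s.length + (w.length + w.length) + t.length := hl.symm
    rw [hn, wd_add, wd_add, wd_add] at h
    have h1 := List.append_inj h (by simp [wd_length])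
    have h2 := List.append_inj h1.1 (by simp [wd_length])
    have h3 := List.append_inj h2.2 (by simp [wd_length])
    refine ⟨i + s.length, by omega, by omega, ?_, h3.1.symm⟩
    rw [sqAt_iff, ← h3.1, ← h3.2]
  · rintro ⟨j, h1, h2, h3, h4⟩
    obtain ⟨a, rfl⟩ := Nat.exists_eq_add_of_le h1
    obtain ⟨b, hb⟩ := Nat.exists_eq_add_of_le h2
    have hn : n = a + (w.length + w.length) + b := by omega
    refine ⟨wd i a, wd (i + (a + (w.length + w.length))) b, ?_⟩
    rw [sqAt_iff] at h3
    conv_rhs => rw [hn, wd_add, wd_add, wd_add, ← h3, h4]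

open Classical in
/-- distinct squares (their roots) of period `p` in the window `[i, i+n)`. -/
noncomputable def sqs (i n p : ℕ) : Finset (List Bool) :=
  ((Finset.Ico i (i + n + 1 - 2 * p)).filter (fun j => SqAt j p)).image (fun j => wd j p)

lemma mem_sqs {i n p : ℕ} {w : List Bool} : w ∈ sqs i n p ↔
    ∃ j, i ≤ j ∧ j + 2 * p ≤ i + n ∧ SqAt j p ∧ wd j p = w := by
  simp only [sqs, Finset.mem_image, Finset.mem_filter, Finset.mem_Ico]
  constructor
  · rintro ⟨j, ⟨⟨h1, h2⟩, h3⟩, h4⟩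
    exact ⟨j, h1, by omega, h3, h4⟩
  · rintro ⟨j, h1, h2, h3, h4⟩
    exact ⟨j, ⟨⟨h1, by omega⟩, h3⟩, h4⟩

lemma length_of_mem_sqs {i n p : ℕ} {w : List Bool} (h : w ∈ sqs i n p) : w.length = p := by
  obtain ⟨j, _, _, _, rfl⟩ := mem_sqs.1 h
  exact wd_length _ _

lemma period_fib {j p : ℕ} (hp : 0 < p) (h : SqAt j p) : ∃ m, p = fib (m + 2) := by
  by_cases h3 : p < 3
  · interval_cases p
    · exact ⟨0, rfl⟩
    · exact ⟨1, rfl⟩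
  · have hex : ∃ m, p < fib (m + 5) :=
      ⟨p, lt_of_lt_of_le (lt_fib_add_three p) (Nat.fib_mono (by omega))⟩
    classical
    have h1 := Nat.find_spec hex
    have h2 : fib (Nat.find hex + 4) ≤ p := by
      rcases hm : Nat.find hex with _ | m
      · have : fib (0 + 4) = 3 := rfl
        omega
      · have := Nat.find_min hex (m := m) (by omega)
        exact not_lt.1 this
    rcases Nat.lt_or_ge (fib (Nat.find hex + 4)) p with h4 | h4
    · exact (not_between h h4 h1).elim
    · exact ⟨Nat.find hex + 2, le_antisymm h4 h2⟩

lemma D2_eq (i n K : ℕ) (hn : n < 2 * fib (K + 2)) :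
    D2 i n = ∑ m ∈ Finset.range K, (sqs (i - 1) n (fib (m + 2))).card := by
  classical
  rw [← Finset.card_biUnion]
  · unfold D2
    rw [← Set.ncard_coe_finset]
    congr 1
    ext w
    simp only [Set.mem_setOf_eq, Finset.coe_biUnion, Finset.coe_range, Set.mem_Iio,
      Set.mem_iUnion, Finset.mem_coe, exists_prop]
    have : fFactor i n = wd (i - 1) n := rfl
    rw [this, infix_iff]
    constructor
    · rintro ⟨hw, j, h1, h2, h3, h4⟩
      obtain ⟨m, hm⟩ := period_fib (List.length_pos_iff.2 hw) h3
      refine ⟨m, ?_, ?_⟩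
      · by_contra hc
        have : fib (K + 2) ≤ fib (m + 2) := Nat.fib_mono (by omega)
        omega
      · rw [← hm]
        exact mem_sqs.2 ⟨j, h1, h2, h3, h4⟩
    · rintro ⟨m, _, h⟩
      have hl := length_of_mem_sqs h
      obtain ⟨j, h1, h2, h3, h4⟩ := mem_sqs.1 h
      have := fib_p1 (m + 1)
      rw [show m + 1 + 1 = m + 2 from rfl] at this
      refine ⟨?_, j, h1, ?_, ?_, ?_⟩
      · rintro rfl; simp at hl; omega
      · rw [hl]; exact h2
      · rw [hl]; exact h3
      · rw [hl]; exact h4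
  · intro a _ b _ hab
    rw [Function.onFun, Finset.disjoint_left]
    intro w h1 h2
    have := (length_of_mem_sqs h1).symm.trans (length_of_mem_sqs h2)
    apply hab
    rcases lt_trichotomy a b with h | h | h
    · have := Nat.fib_lt_fib_succ (n := a + 2) (by omega)
      have : fib (a + 2 + 1) ≤ fib (b + 2) := Nat.fib_mono (by omega)
      omega
    · exact h
    · have := Nat.fib_lt_fib_succ (n := b + 2) (by omega)
      have : fib (b + 2 + 1) ≤ fib (a + 2) := Nat.fib_mono (by omega)
      omega

/-! ### Upper bound -/

lemma sq_offset {k u r : ℕ} (hsq : SqAt (cut (k + 2) u + r) (fib (k + 2)))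
    (hr : r < bl (k + 2) (fibWord u)) :
    r < fib (k + 1) ∨ (fibWord u = false ∧ fib (k + 3) ≤ r ∧ r < fib (k + 4)) := by
  have f3 := fib_s2 k
  rcases Nat.lt_or_ge r (fib (k + 3)) with h | h
  · left
    by_contra hc
    have := hsq (fib (k + 3) - 1 - r) (by omega)
    apply mismatch k u
    convert this using 2 <;> omega
  · right
    cases hu : fibWord u with
    | false => rw [hu] at hr; exact ⟨rfl, h, hr⟩
    | true => rw [hu] at hr; have : r < fib (k + 3) := hr; omega

lemma sq_offset2 {k u r : ℕ} (hu : fibWord u = false)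
    (hsq : SqAt (cut (k + 2) u + r) (fib (k + 3))) (hr : r < fib (k + 4)) : r < fib (k + 2) := by
  have f3 := fib_s2 k
  have f4 := fib_s3 k
  have f5 := fib_s4 k
  have h1 : fibWord (fib (k + 4) - 1) ≠ fibWord (fib (k + 5) - 1) := F_last (k + 2)
  by_contra hc
  have := hsq (fib (k + 4) - 1 - r) (by omega)
  rw [show cut (k + 2) u + r + (fib (k + 4) - 1 - r) = cut (k + 2) u + (fib (k + 4) - 1) by omega,
    show cut (k + 2) u + r + fib (k + 3) + (fib (k + 4) - 1 - r) =
      cut (k + 2) u + (fib (k + 5) - 1) by omega,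
    F_block_a (k := k + 1) hu (show _ < fib (k + 5) by omega),
    F_block_a (k := k + 1) hu (show _ < fib (k + 5) by omega)] at this
  exact h1 this

lemma wd_offset {k u r : ℕ} (hr : r < bl (k + 2) (fibWord u))
    (h : r < fib (k + 1) ∨ (fibWord u = false ∧ fib (k + 3) ≤ r ∧ r < fib (k + 4))) :
    wd (cut (k + 2) u + r) (fib (k + 2)) = wd r (fib (k + 2)) := by
  have f3 := fib_s2 k
  have f4 := fib_s3 k
  have f5 := fib_s4 k
  rw [wd_eq_iff]
  intro t ht
  rw [add_assoc]
  rcases h with h | ⟨hu, h1, h2⟩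
  · apply F_block (k + 1)
    exact lt_of_lt_of_le (by omega : _ < fib (k + 3)) (bl_ge (k + 2) _)
  · apply F_block_a (k := k + 1) hu
    show _ < fib (k + 5)
    omega

lemma wd_shift {k r : ℕ} (hk : 1 ≤ k) (h : r < fib (k + 1)) :
    wd (fib (k + 3) + r) (fib (k + 2)) = wd r (fib (k + 2)) := by
  have f3 := fib_s2 k
  have f4 := fib_s3 k
  have f2 : fib (1 + 2) ≤ fib (k + 2) := Nat.fib_mono (by omega)
  have f2' : fib (1 + 2) = 2 := rfl
  rw [wd_eq_iff]
  intro t ht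
  rw [add_assoc]
  apply F_near
  omega

lemma sqs_card_le (i n k : ℕ) : (sqs i n (fib (k + 2))).card ≤ fib (k + 2) := by
  classical
  rcases Nat.eq_zero_or_pos k with rfl | hk
  · have : sqs i n (fib (0 + 2)) ⊆ {[false]} := by
      intro w hw
      obtain ⟨j, -, -, h3, rfl⟩ := mem_sqs.1 hw
      have h4 := h3 0 (by decide)
      have h5 := no_bb j
      have e : fib (0 + 2) = 1 := rfl
      rw [e] at h4 ⊢
      rw [Finset.mem_singleton]
      simp only [add_zero] at h4
      have : wd j 1 = [fibWord j] := rfl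
      rw [this]
      cases hj : fibWord j with
      | false => rfl
      | true => rw [← h4, hj] at h5; simp at h5
    exact (Finset.card_le_card this).trans (by simp)
  · have : sqs i n (fib (k + 2)) ⊆
        (Finset.range (fib (k + 2))).image (fun t => wd (fib (k + 3) + t) (fib (k + 2))) := by
      intro w hw
      obtain ⟨j, -, -, h3, rfl⟩ := mem_sqs.1 hw
      obtain ⟨u, r, rfl, hr⟩ := exists_cut (k + 2) j
      have ho := sq_offset h3 hr
      have f4 := fib_s3 k
      have f2 := fib_le1 k
      rw [wd_offset hr ho, Finset.mem_image]
      rcases ho with h | ⟨_, h1, h2⟩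
      · exact ⟨r, by rw [Finset.mem_range]; omega, wd_shift hk h⟩
      · refine ⟨r - fib (k + 3), by rw [Finset.mem_range]; omega, ?_⟩
        congr 1; omega
    exact (Finset.card_le_card this).trans (Finset.card_image_le.trans (by simp))

lemma cut_unique {k u u' r r' : ℕ} (h : cut k u + r = cut k u' + r')
    (hr : r < bl k (fibWord u)) (hr' : r' < bl k (fibWord u')) : u = u' := by
  have m := (cut_strictMono k).monotone
  have e := cut_succ k u
  have e' := cut_succ k u'
  rcases lt_trichotomy u u' with h1 | h1 | h1
  · have := m (show u + 1 ≤ u' by omega); omega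
  · exact h1
  · have := m (show u' + 1 ≤ u by omega); omega

/-- the special positions -/
def IsZ (k j : ℕ) : Prop := ∃ u r, j = cut (k + 2) u + r ∧ fibWord u = false ∧
  fib (k + 3) + fib (k + 1) ≤ r ∧ r < fib (k + 4)

open Classical in
lemma sqs_card_le_Z (i n k : ℕ) (hk : 1 ≤ k) : (sqs i n (fib (k + 2))).card ≤ fib (k + 1) +
    ((Finset.Ico i (i + n + 1 - 2 * fib (k + 2))).filter (IsZ k)).card := by
  have : sqs i n (fib (k + 2)) ⊆
      (Finset.range (fib (k + 1))).image (fun t => wd t (fib (k + 2))) ∪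
      ((Finset.Ico i (i + n + 1 - 2 * fib (k + 2))).filter (IsZ k)).image
        (fun t => wd t (fib (k + 2))) := by
    intro w hw
    obtain ⟨j, h1, h2, h3, rfl⟩ := mem_sqs.1 hw
    obtain ⟨u, r, rfl, hr⟩ := exists_cut (k + 2) j
    have ho := sq_offset h3 hr
    have hwd := wd_offset hr ho
    rw [Finset.mem_union, Finset.mem_image, Finset.mem_image]
    rcases ho with h | ⟨hu, h4, h5⟩
    · left
      exact ⟨r, by rw [Finset.mem_range]; omega, hwd.symm⟩
    · by_cases h6 : r < fib (k + 3) + fib (k + 1)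
      · left
        refine ⟨r - fib (k + 3), by rw [Finset.mem_range]; omega, ?_⟩
        rw [hwd, ← wd_shift hk (by omega)]
        congr 1; omega
      · right
        refine ⟨_, ?_, rfl⟩
        rw [Finset.mem_filter, Finset.mem_Ico]
        exact ⟨⟨h1, by omega⟩, u, r, rfl, hu, by omega, h5⟩
  refine (Finset.card_le_card this).trans ((Finset.card_union_le _ _).trans ?_)
  gcongr
  · exact Finset.card_image_le.trans (by simp)
  · exact Finset.card_image_le

open Classical in
lemma Z_card_le (i n k j₁ : ℕ) (h1 : i ≤ j₁) (h2 : j₁ + 2 * fib (k + 3) ≤ i + n)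
    (h3 : SqAt j₁ (fib (k + 3))) :
    ((Finset.Ico i (i + n + 1 - 2 * fib (k + 2))).filter (IsZ k)).card ≤
    ((Finset.Ico i (i + n + 1 - 2 * fib (k + 3))).filter (fun j => ¬ SqAt j (fib (k + 3)))).card := by
  have f2 := fib_s k
  have f3 := fib_s2 k
  have f4 := fib_s3 k
  have fp := fib_p1 k
  have f0 : fib k ≤ fib (k + 1) := Nat.fib_le_fib_succ
  apply Finset.card_le_card_of_injOn
    (fun j => if j < i + n + 1 - 2 * fib (k + 3) then j else j - 2 * fib (k + 1))
  · intro j hj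
    rw [Finset.mem_coe, Finset.mem_filter, Finset.mem_Ico] at hj
    obtain ⟨⟨hj1, hj2⟩, u, r, rfl, hu, hr1, hr2⟩ := hj
    rw [Finset.mem_coe, Finset.mem_filter, Finset.mem_Ico]
    dsimp only
    split_ifs with hlt
    · refine ⟨⟨hj1, hlt⟩, fun hs => ?_⟩
      have := sq_offset2 hu hs hr2
      omega
    · have hge : i ≤ cut (k + 2) u + r - 2 * fib (k + 1) := by
        by_contra hc
        obtain ⟨r1, hr1'⟩ := Nat.exists_eq_add_of_le (show cut (k + 2) u ≤ j₁ by omega)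
        rw [hr1'] at h3
        have := sq_offset2 hu h3 (by omega)
        omega
      refine ⟨⟨hge, by omega⟩, fun hs => ?_⟩
      rw [Nat.add_sub_assoc (by omega)] at hs
      have := sq_offset2 hu hs (by omega)
      omega
  · have key : ∀ j j', IsZ k j → IsZ k j' → j = j' - 2 * fib (k + 1) → False := by
      rintro j j' ⟨u, r, rfl, hu, hr1, hr2⟩ ⟨u', r', rfl, hu', hr1', hr2'⟩ h
      rw [Nat.add_sub_assoc (by omega)] at h
      have := cut_unique h (by rw [hu]; exact hr2)
        (by rw [hu']; exact lt_of_le_of_lt (Nat.sub_le _ _) hr2')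
      subst this
      omega
    intro j hj j' hj' h
    rw [Finset.mem_coe, Finset.mem_filter, Finset.mem_Ico] at hj hj'
    dsimp only at h
    split_ifs at h with a b b
    · exact h
    · exact (key _ _ hj.2 hj'.2 h).elim
    · exact (key _ _ hj'.2 hj.2 h.symm).elim
    · have : 2 * fib (k + 1) ≤ j := by
        obtain ⟨_, u, r, rfl, hu, hr1, hr2⟩ := hj
        omega
      have : 2 * fib (k + 1) ≤ j' := by
        obtain ⟨_, u, r, rfl, hu, hr1, hr2⟩ := hj'
        omega
      omega

lemma sum_fib (k : ℕ) : ∑ m ∈ Finset.range k, fib (m + 2) + 2 = fib (k + 3) := by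
  induction k with
  | zero => rfl
  | succ k ih =>
    rw [Finset.sum_range_succ]
    have := fib_s3 k
    have e : fib (k + 1 + 3) = fib (k + 4) := rfl
    omega

lemma D2_upper (i n k : ℕ) (hk : 1 ≤ k) (hn : n < 2 * fib (k + 4)) :
    D2 i n ≤ fib (k + 4) ∨ D2 i n + fib (k + 2) ≤ n := by
  classical
  rw [D2_eq i n (k + 2) hn, Finset.sum_range_succ, Finset.sum_range_succ]
  have h1 : ∑ m ∈ Finset.range k, (sqs (i - 1) n (fib (m + 2))).card ≤
      ∑ m ∈ Finset.range k, fib (m + 2) := Finset.sum_le_sum fun m _ => sqs_card_le _ _ _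
  have h2 := sum_fib k
  have f3 := fib_s2 k
  have f4 := fib_s3 k
  have e : k + 1 + 2 = k + 3 := rfl
  rw [e]
  by_cases hne : (sqs (i - 1) n (fib (k + 3))).card = 0
  · left
    have := sqs_card_le (i - 1) n k
    omega
  · right
    obtain ⟨w, hw⟩ := Finset.card_pos.1 (Nat.pos_of_ne_zero hne)
    obtain ⟨j, h3, h4, h5, -⟩ := mem_sqs.1 hw
    have h6 := Z_card_le _ n k j h3 h4 h5
    have h7 := sqs_card_le_Z (i - 1) n k hk
    have h8 : (sqs (i - 1) n (fib (k + 3))).card ≤ ((Finset.Ico (i - 1)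
      (i - 1 + n + 1 - 2 * fib (k + 3))).filter (fun j => SqAt j (fib (k + 3)))).card :=
      Finset.card_image_le
    have h9 := Finset.card_filter_add_card_filter_not
      (s := Finset.Ico (i - 1) (i - 1 + n + 1 - 2 * fib (k + 3)))
      (fun j => SqAt j (fib (k + 3)))
    rw [Nat.card_Ico] at h9
    omega
/-! ### Lower bound -/

lemma exists_mismatch (l y : ℕ) : ∃ x, x < fib (l + 4) ∧
    fibWord (y + x) ≠ fibWord (y + x + fib (l + 2)) := by
  have f4 := fib_s3 l
  have fp := fib_p1 (l + 2)
  rw [show l + 2 + 1 = l + 3 from rfl] at fp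
  obtain ⟨u, r, rfl, hr⟩ := exists_cut (l + 2) y
  by_cases h : r < fib (l + 3)
  · refine ⟨fib (l + 3) - 1 - r, by omega, ?_⟩
    have := mismatch l u
    rwa [show cut (l + 2) u + r + (fib (l + 3) - 1 - r) = cut (l + 2) u + (fib (l + 3) - 1) by omega]
  · have e := cut_succ (l + 2) u
    have hb : bl (l + 2) (fibWord u) ≤ fib (l + 4) := bl_le (l + 2) _
    refine ⟨cut (l + 2) (u + 1) + (fib (l + 3) - 1) - (cut (l + 2) u + r), by omega, ?_⟩
    have := mismatch l (u + 1)
    rwa [show cut (l + 2) u + r + (cut (l + 2) (u + 1) + (fib (l + 3) - 1) -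
      (cut (l + 2) u + r)) = cut (l + 2) (u + 1) + (fib (l + 3) - 1) by omega]

lemma sq_run {k u t : ℕ} (hu : fibWord u = false) (ht : t + 1 < fib (k + 3)) :
    SqAt (cut (k + 2) u + fib (k + 3) + t) (fib (k + 2)) := by
  have f3 := fib_s2 k
  have f4 := fib_s3 k
  have f5 := fib_s4 k
  intro x hx
  have e := cut_succ_a (k := k + 2) hu
  rw [show k + 2 + 2 = k + 4 from rfl] at e
  have h1 : fibWord (cut (k + 2) u + fib (k + 3) + t + x) = fibWord (t + x) := by
    rw [show cut (k + 2) u + fib (k + 3) + t + x = cut (k + 2) u + (fib (k + 3) + (t + x)) by omega,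
      F_block_a (k := k + 1) hu (show _ < fib (k + 5) by omega), F_near k _ (by omega)]
  have h2 : fibWord (cut (k + 2) (u + 1) + (t + x)) = fibWord (t + x) := by
    cases hv : fibWord (u + 1) with
    | false => exact F_block_a (k := k + 1) hv (show _ < fib (k + 5) by omega)
    | true =>
      by_cases hlt : t + x < fib (k + 3)
      · apply F_block (k + 1); rw [hv]; exact hlt
      · obtain ⟨z, hz⟩ := Nat.exists_eq_add_of_le (not_lt.1 hlt)
        have e' := cut_succ_b (k := k + 2) hv
        rw [show k + 2 + 1 = k + 3 from rfl] at e'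
        rw [hz, F_near k z (by omega), ← add_assoc, ← e']
        exact F_block_a (k := k + 1) (no_bb _ hv) (show _ < fib (k + 5) by omega)
  rw [h1, ← h2]
  congr 1
  omega

lemma sq_distinct {k j d : ℕ} (h1 : SqAt j (fib (k + 2))) (h2 : SqAt (j + d) (fib (k + 2)))
    (hd : 0 < d) (hd2 : d < fib (k + 2)) (h : wd j (fib (k + 2)) = wd (j + d) (fib (k + 2))) :
    False := by
  rw [wd_eq_iff] at h
  have key : ∀ x < 2 * fib (k + 2), fibWord (j + x) = fibWord (j + d + x) := by
    intro x hx
    by_cases hlt : x < fib (k + 2)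
    · exact h x hlt
    · obtain ⟨z, rfl⟩ := Nat.exists_eq_add_of_le (not_lt.1 hlt)
      rw [← add_assoc, ← add_assoc, ← h1 z (by omega), ← h2 z (by omega)]
      exact h z (by omega)
  obtain ⟨l, rfl⟩ := period_fib (j := j) hd (fun t ht => key t (by omega))
  have hl : l + 3 ≤ k + 2 := by
    by_contra hc
    have : fib (k + 2) ≤ fib (l + 2) := Nat.fib_mono (by omega)
    omega
  have hm : fib (l + 3) ≤ fib (k + 2) := Nat.fib_mono hl
  have f4 := fib_s3 l
  have f0 := fib_le1 (l + 1)
  rw [show l + 1 + 1 = l + 2 from rfl, show l + 1 + 2 = l + 3 from rfl] at f0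
  obtain ⟨x, hx, hne⟩ := exists_mismatch l j
  apply hne
  rw [key x (by omega)]
  congr 1; omega

lemma card_sqs_ge {i n k j N : ℕ} (hN : N ≤ fib (k + 2)) (hi : i ≤ j)
    (hw : j + N + 2 * fib (k + 2) ≤ i + n + 1)
    (hsq : ∀ t < N, SqAt (j + t) (fib (k + 2))) : N ≤ (sqs i n (fib (k + 2))).card := by
  classical
  have hinj : ∀ t t', t < t' → t' < N →
      wd (j + t) (fib (k + 2)) = wd (j + t') (fib (k + 2)) → False := by
    intro t t' hlt ht' he
    obtain ⟨d, rfl⟩ := Nat.exists_eq_add_of_lt hlt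
    refine sq_distinct (d := d + 1) (hsq t (by omega)) ?_ (by omega) (by omega) ?_
    · rw [show j + t + (d + 1) = j + (t + d + 1) by omega]; exact hsq _ ht'
    · rw [show j + t + (d + 1) = j + (t + d + 1) by omega]; exact he
  have hc : ((Finset.range N).image (fun t => wd (j + t) (fib (k + 2)))).card = N := by
    rw [Finset.card_image_of_injOn, Finset.card_range]
    intro t ht t' ht' he
    rw [Finset.mem_coe, Finset.mem_range] at ht ht'
    rcases lt_trichotomy t t' with h | h | h
    · exact (hinj _ _ h ht' he).elim
    · exact h
    · exact (hinj _ _ h ht he.symm).elim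
  rw [← hc]
  apply Finset.card_le_card
  intro w hw'
  obtain ⟨t, ht, rfl⟩ := Finset.mem_image.1 hw'
  rw [Finset.mem_range] at ht
  exact mem_sqs.2 ⟨j + t, by omega, by omega, hsq t ht, rfl⟩

lemma cut_fib (q n : ℕ) : cut q (fib (n + 2)) = fib (n + q + 2) := by
  induction q generalizing n with
  | zero => rw [cut_zero_level]
  | succ q ih =>
    rw [cut_level_succ, (cut_one_fib_add n).1, ih (n + 1)]
    congr 1; omega

lemma D2_lower (n k : ℕ) (hn : 2 * fib (k + 3) ≤ n) (hn2 : n < 2 * fib (k + 4)) :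
    fib (k + 4) + (n - fib (k + 4) - fib (k + 2)) ≤ D2 (fib (k + 3) + fib (k + 1)) n + 2 := by
  have f3 := fib_s2 k
  have f4 := fib_s3 k
  have fp := fib_p1 k
  have fp2 := fib_p1 (k + 1)
  rw [show k + 1 + 1 = k + 2 from rfl] at fp2
  rw [D2_eq _ n (k + 2) hn2, Finset.sum_range_succ, Finset.sum_range_succ]
  have e : k + 1 + 2 = k + 3 := rfl
  rw [e]
  have h2 := sum_fib k
  obtain ⟨i, hi⟩ : ∃ i, i = fib (k + 3) + fib (k + 1) - 1 := ⟨_, rfl⟩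
  rw [← hi]
  have fl := fib_le1 k
  have fm : fib (k + 2) ≤ 2 * fib (k + 1) := by
    have a := Nat.fib_add_two (n := k)
    have b : fib k ≤ fib (k + 1) := Nat.fib_mono (by omega)
    omega
  have h1 : ∑ m ∈ Finset.range k, fib (m + 2) ≤
      ∑ m ∈ Finset.range k, (sqs i n (fib (m + 2))).card := by
    apply Finset.sum_le_sum
    intro m hm
    rw [Finset.mem_range] at hm
    have g3 := fib_s2 m
    have g4 := fib_s3 m
    have m4 : fib (m + 4) ≤ fib (k + 3) := Nat.fib_mono (by omega)
    have m2 : fib (m + 2) ≤ fib (k + 1) := Nat.fib_mono (by omega)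
    have gp := fib_p1 m
    obtain ⟨c, rfl⟩ := Nat.exists_eq_add_of_lt hm
    have hcut : cut (m + 2) (fib (c + 3)) = fib (m + c + 1 + 4) := by
      rw [show c + 3 = c + 1 + 2 from rfl, cut_fib]
      congr 1; omega
    have hF : fibWord (fib (c + 3)) = false := by
      have := F_rec c 0 (Nat.fib_pos.2 (by omega))
      rwa [add_zero] at this
    refine card_sqs_ge (j := fib (m + c + 1 + 4) + fib (m + 3)) le_rfl (by omega) (by omega) ?_
    intro t ht
    rw [← hcut]
    exact sq_run hF (by omega)
  have hk : fib (k + 2) ≤ (sqs i n (fib (k + 2))).card := by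
    refine card_sqs_ge (j := i) le_rfl le_rfl (by omega) ?_
    intro t ht
    have := sq_run (k := k) (u := 0) (t := fib (k + 1) - 1 + t) F_zero (by omega)
    convert this using 1
    show i + t = 0 + fib (k + 3) + (fib (k + 1) - 1 + t)
    omega
  have hk1 : n - fib (k + 4) - fib (k + 2) ≤ (sqs i n (fib (k + 3))).card := by
    by_cases h0 : n ≤ fib (k + 4) + fib (k + 2)
    · omega
    · refine card_sqs_ge (k := k + 1) (j := fib (k + 4)) ?_ (by omega) ?_ ?_
      · show _ ≤ fib (k + 3)
        omega
      · show _ + 2 * fib (k + 3) ≤ _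
        omega
      intro t ht
      have := sq_run (k := k + 1) (u := 0) (t := t) F_zero (show _ < fib (k + 4) by omega)
      convert this using 1
      show _ = 0 + fib (k + 4) + t
      omega
  omega

/-! ### The maximum -/

lemma exists_level (n : ℕ) (hn : 6 ≤ n) : ∃ k, 1 ≤ k ∧ 2 * fib (k + 3) ≤ n ∧ n < 2 * fib (k + 4) := by
  have hex : ∃ m, n < 2 * fib (m + 1 + 4) := ⟨n, by
    have := lt_of_lt_of_le (lt_fib_add_three n) (Nat.fib_mono (show n + 3 ≤ n + 1 + 4 by omega))
    omega⟩
  classical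
  refine ⟨Nat.find hex + 1, by omega, ?_, Nat.find_spec hex⟩
  rcases hm : Nat.find hex with _ | m
  · have : fib (0 + 1 + 3) = 3 := rfl
    omega
  · have := Nat.find_min hex (m := m) (by omega)
    exact not_lt.1 this

lemma D2_bdd (n : ℕ) : BddAbove {d : ℕ | ∃ i, 1 ≤ i ∧ D2 i n = d} := by
  refine ⟨∑ m ∈ Finset.range n, fib (m + 2), ?_⟩
  rintro d ⟨i, _, rfl⟩
  rw [D2_eq i n n (by
    have : n < fib (n + 3) := lt_fib_add_three n
    have h2 := fib_s2 n
    have := fib_le1 n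
    omega)]
  exact Finset.sum_le_sum fun m _ => sqs_card_le _ _ _

lemma max_upper (n k : ℕ) (hk : 1 ≤ k) (hn : n < 2 * fib (k + 4)) :
    maxD2 n ≤ fib (k + 4) ∨ maxD2 n + fib (k + 2) ≤ n := by
  have : maxD2 n ∈ {d : ℕ | ∃ i, 1 ≤ i ∧ D2 i n = d} :=
    Nat.sSup_mem ⟨_, 1, le_rfl, rfl⟩ (D2_bdd n)
  obtain ⟨i, _, h⟩ := this
  rw [← h]
  exact D2_upper i n k hk hn

lemma max_lower (n k : ℕ) (hn : 2 * fib (k + 3) ≤ n) (hn2 : n < 2 * fib (k + 4)) :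
    fib (k + 4) + (n - fib (k + 4) - fib (k + 2)) ≤ maxD2 n + 2 := by
  refine (D2_lower n k hn hn2).trans (Nat.add_le_add_right ?_ 2)
  exact le_csSup (D2_bdd n) ⟨_, by have := fib_p1 k; omega, rfl⟩

/-! ### Asymptotics -/

lemma fib_approx (n : ℕ) : |(fib (n + 1) : ℝ) - (1 + Real.sqrt 5) / 2 * fib n| ≤ 1 := by
  have h := Real.fib_succ_sub_goldenRatio_mul_fib n
  rw [Real.goldenRatio] at h
  rw [h, abs_pow]
  apply pow_le_one₀ (abs_nonneg _)
  rw [abs_le]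
  have h1 := Real.neg_one_lt_goldenConj
  have h2 := Real.goldenConj_neg
  constructor <;> linarith

lemma level_real (k : ℕ) : ∃ e : ℝ, |e| ≤ 1 ∧
    (fib (k + 3) : ℝ) = (1 + Real.sqrt 5) / 2 * fib (k + 2) + e ∧
    (fib (k + 4) : ℝ) = fib (k + 2) + (1 + Real.sqrt 5) / 2 * fib (k + 2) + e := by
  refine ⟨fib (k + 3) - (1 + Real.sqrt 5) / 2 * fib (k + 2), fib_approx (k + 2), by ring, ?_⟩
  rw [fib_s3 k]; push_cast; ring

lemma limsup_aux (u : ℕ → ℝ) (L C : ℝ) (N : ℕ) (h0 : ∀ n, 0 ≤ u n)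
    (h1 : ∀ n ≥ N, u n ≤ L * n + C) (h2 : ∀ M, ∃ n ≥ M, L * n - C ≤ u n) :
    Filter.limsup (fun n : ℕ => u n / n) Filter.atTop = L := by
  have hC : Filter.Tendsto (fun n : ℕ => C / (n : ℝ)) Filter.atTop (nhds 0) :=
    tendsto_const_div_atTop_nhds_zero_nat C
  have hup : ∀ᶠ n : ℕ in Filter.atTop, u n / n ≤ L + C / n := by
    filter_upwards [Filter.eventually_ge_atTop N, Filter.eventually_ge_atTop 1] with n hn hn1
    have hp : (0 : ℝ) < n := by exact_mod_cast hn1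
    rw [div_le_iff₀ hp, add_mul, div_mul_cancel₀ _ hp.ne']
    exact h1 n hn
  have ht : Filter.Tendsto (fun n : ℕ => L + C / (n : ℝ)) Filter.atTop (nhds L) := by
    simpa using hC.const_add L
  have hbd : Filter.IsBoundedUnder (· ≤ ·) Filter.atTop (fun n : ℕ => u n / n) :=
    ht.isBoundedUnder_le.mono_le hup
  have hcb : Filter.IsCoboundedUnder (· ≤ ·) Filter.atTop (fun n : ℕ => u n / n) :=
    (Filter.isBoundedUnder_of ⟨0, fun n => div_nonneg (h0 n) (Nat.cast_nonneg n)⟩ :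
      Filter.IsBoundedUnder (· ≥ ·) Filter.atTop (fun n : ℕ => u n / n)).isCoboundedUnder_le
  apply le_antisymm
  · rw [← ht.limsup_eq]
    exact Filter.limsup_le_limsup hup hcb ht.isBoundedUnder_le
  · apply le_of_forall_lt
    intro b hb
    obtain ⟨b', hb1, hb2⟩ := exists_between hb
    refine lt_of_lt_of_le hb1 ?_
    apply Filter.le_limsup_of_frequently_le _ hbd
    rw [Filter.frequently_atTop]
    intro M
    have hev : ∀ᶠ n : ℕ in Filter.atTop, C / (n : ℝ) < L - b' :=
      hC.eventually (gt_mem_nhds (by linarith))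
    obtain ⟨M', hM'⟩ := Filter.eventually_atTop.1 hev
    obtain ⟨n, hn, hu⟩ := h2 (M + M' + 1)
    have hp : (0 : ℝ) < n := by exact_mod_cast (show 0 < n by omega)
    refine ⟨n, by omega, ?_⟩
    have h3 := hM' n (by omega)
    rw [div_lt_iff₀ hp] at h3
    rw [le_div_iff₀ hp]
    nlinarith

lemma liminf_aux (u : ℕ → ℝ) (L C : ℝ) (N B : ℕ) (h0 : ∀ n, 0 ≤ u n) (hB : ∀ n ≥ B, u n ≤ 2 * n)
    (h1 : ∀ n ≥ N, L * n - C ≤ u n) (h2 : ∀ M, ∃ n ≥ M, u n ≤ L * n + C) :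
    Filter.liminf (fun n : ℕ => u n / n) Filter.atTop = L := by
  have hC : Filter.Tendsto (fun n : ℕ => C / (n : ℝ)) Filter.atTop (nhds 0) :=
    tendsto_const_div_atTop_nhds_zero_nat C
  have hup : ∀ᶠ n : ℕ in Filter.atTop, L - C / n ≤ u n / n := by
    filter_upwards [Filter.eventually_ge_atTop N, Filter.eventually_ge_atTop 1] with n hn hn1
    have hp : (0 : ℝ) < n := by exact_mod_cast hn1
    rw [le_div_iff₀ hp, sub_mul, div_mul_cancel₀ _ hp.ne']
    exact h1 n hn
  have ht : Filter.Tendsto (fun n : ℕ => L - C / (n : ℝ)) Filter.atTop (nhds L) := by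
    simpa using hC.const_sub L
  have hbd : Filter.IsBoundedUnder (· ≥ ·) Filter.atTop (fun n : ℕ => u n / n) :=
    Filter.isBoundedUnder_of ⟨0, fun n => div_nonneg (h0 n) (Nat.cast_nonneg n)⟩
  have hcb : Filter.IsCoboundedUnder (· ≥ ·) Filter.atTop (fun n : ℕ => u n / n) := by
    apply Filter.IsBoundedUnder.isCoboundedUnder_ge
    refine Filter.isBoundedUnder_of_eventually_le (a := 2) ?_
    filter_upwards [Filter.eventually_ge_atTop B, Filter.eventually_ge_atTop 1] with n hn hn1
    have hp : (0 : ℝ) < n := by exact_mod_cast hn1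
    rw [div_le_iff₀ hp]
    exact hB n hn
  apply le_antisymm
  · apply le_of_forall_gt
    intro b hb
    obtain ⟨b', hb1, hb2⟩ := exists_between hb
    refine lt_of_le_of_lt ?_ hb2
    apply Filter.liminf_le_of_frequently_le _ hbd
    rw [Filter.frequently_atTop]
    intro M
    have hev : ∀ᶠ n : ℕ in Filter.atTop, C / (n : ℝ) < b' - L :=
      hC.eventually (gt_mem_nhds (by linarith))
    obtain ⟨M', hM'⟩ := Filter.eventually_atTop.1 hev
    obtain ⟨n, hn, hu⟩ := h2 (M + M' + 1)
    have hp : (0 : ℝ) < n := by exact_mod_cast (show 0 < n by omega)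
    refine ⟨n, by omega, ?_⟩
    have h3 := hM' n (by omega)
    rw [div_lt_iff₀ hp] at h3
    rw [div_le_iff₀ hp]
    nlinarith
  · rw [← ht.liminf_eq]
    exact Filter.liminf_le_liminf hup ht.isBoundedUnder_ge hcb

lemma alpha_facts : ((1 + Real.sqrt 5) / 2) ^ 2 = (1 + Real.sqrt 5) / 2 + 1 ∧
    1 < (1 + Real.sqrt 5) / 2 ∧ (1 + Real.sqrt 5) / 2 < 2 := by
  have h := Real.sq_sqrt (show (0 : ℝ) ≤ 5 by norm_num)
  have h0 := Real.sqrt_nonneg 5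
  refine ⟨by nlinarith, by nlinarith, by nlinarith⟩

lemma upper_real (n : ℕ) (hn : 6 ≤ n) : (maxD2 n : ℝ) ≤ (1 + Real.sqrt 5) / 4 * n + 10 := by
  obtain ⟨k, hk, h1, h2⟩ := exists_level n hn
  obtain ⟨e, he, h3, h4⟩ := level_real k
  obtain ⟨ha, ha1, ha2⟩ := alpha_facts
  have e4 : (1 + Real.sqrt 5) / 4 = (1 + Real.sqrt 5) / 2 / 2 := by ring
  rw [e4]
  generalize (1 + Real.sqrt 5) / 2 = α at *
  obtain ⟨he1, he2⟩ := abs_le.1 he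
  have h1' : 2 * (fib (k + 3) : ℝ) ≤ n := by exact_mod_cast h1
  have h2' : (n : ℝ) < 2 * (fib (k + 4) : ℝ) := by exact_mod_cast h2
  rcases max_upper n k hk h2 with h | h
  · have h' : (maxD2 n : ℝ) ≤ fib (k + 4) := by exact_mod_cast h
    have : α * (2 * (fib (k + 3) : ℝ)) ≤ α * n := by gcongr
    rw [h3] at this
    rw [h4] at h'
    nlinarith
  · have h' : (maxD2 n : ℝ) + fib (k + 2) ≤ n := by exact_mod_cast h
    rw [h4] at h2'
    have : (1 - α / 2) * n ≤ (1 - α / 2) * (2 * (fib (k + 2) + α * fib (k + 2) + e)) := by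
      apply mul_le_mul_of_nonneg_left h2'.le; linarith
    nlinarith

lemma lower_real (n : ℕ) (hn : 6 ≤ n) : (3 * ((1 + Real.sqrt 5) / 2) + 2) /
    (4 * ((1 + Real.sqrt 5) / 2) + 3) * n - 10 ≤ (maxD2 n : ℝ) := by
  obtain ⟨k, hk, h1, h2⟩ := exists_level n hn
  obtain ⟨e, he, h3, h4⟩ := level_real k
  obtain ⟨ha, ha1, ha2⟩ := alpha_facts
  generalize (1 + Real.sqrt 5) / 2 = α at *
  obtain ⟨he1, he2⟩ := abs_le.1 he
  have h := max_lower n k h1 h2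
  have l1 : (fib (k + 4) : ℝ) ≤ maxD2 n + 2 := by
    exact_mod_cast (show fib (k + 4) ≤ maxD2 n + 2 by omega)
  have l2 : (n : ℝ) ≤ maxD2 n + 2 + fib (k + 2) := by
    exact_mod_cast (show n ≤ maxD2 n + 2 + fib (k + 2) by omega)
  have hpos : 0 < 4 * α + 3 := by linarith
  rw [sub_le_iff_le_add, div_mul_eq_mul_div, div_le_iff₀ hpos]
  rw [h4] at l1
  have m2 : (3 * α + 2) * n ≤ (3 * α + 2) * (maxD2 n + 2 + fib (k + 2)) := by
    apply mul_le_mul_of_nonneg_left l2; linarith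
  have m1 : (α + 1) * (fib (k + 2) + α * fib (k + 2) + e) ≤ (α + 1) * (maxD2 n + 2) := by
    apply mul_le_mul_of_nonneg_left l1; linarith
  have m0 : (α + 1) * (fib (k + 2) + α * fib (k + 2) + e) =
      (3 * α + 2) * fib (k + 2) + (α + 1) * e := by
    linear_combination (fib (k + 2) : ℝ) * ha
  have m3 : -(α + 1) ≤ (α + 1) * e := by nlinarith
  nlinarith

lemma freq_sup (M : ℕ) : ∃ n ≥ M, (1 + Real.sqrt 5) / 4 * n - 10 ≤ (maxD2 n : ℝ) := by
  have hM := lt_fib_add_three M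
  refine ⟨2 * fib (M + 3), by omega, ?_⟩
  have h := max_lower (2 * fib (M + 3)) M le_rfl (by
    have := fib_s3 M
    have := fib_p1 (M + 1)
    rw [show M + 1 + 1 = M + 2 from rfl] at this
    omega)
  obtain ⟨e, he, h3, h4⟩ := level_real M
  obtain ⟨ha, ha1, ha2⟩ := alpha_facts
  have e4 : (1 + Real.sqrt 5) / 4 = (1 + Real.sqrt 5) / 2 / 2 := by ring
  rw [e4]
  generalize (1 + Real.sqrt 5) / 2 = α at *
  obtain ⟨he1, he2⟩ := abs_le.1 he
  have l1 : (fib (M + 4) : ℝ) ≤ maxD2 (2 * fib (M + 3)) + 2 := by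
    exact_mod_cast (show fib (M + 4) ≤ maxD2 (2 * fib (M + 3)) + 2 by omega)
  rw [h4] at l1
  generalize (maxD2 (2 * fib (M + 3)) : ℝ) = D at *
  push_cast
  rw [h3]
  nlinarith

lemma freq_inf (M : ℕ) : ∃ n ≥ M, (maxD2 n : ℝ) ≤ (3 * ((1 + Real.sqrt 5) / 2) + 2) /
    (4 * ((1 + Real.sqrt 5) / 2) + 3) * n + 10 := by
  have hM := lt_fib_add_three M
  have f3 := fib_s2 (M + 1)
  have f4 := fib_s3 (M + 1)
  have f2 := fib_le1 (M + 1)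
  simp only [add_assoc, Nat.reduceAdd] at f3 f4 f2
  have fp := fib_p1 (M + 2)
  simp only [add_assoc, Nat.reduceAdd] at fp
  refine ⟨fib (M + 5) + fib (M + 3), by omega, ?_⟩
  have h := max_upper (fib (M + 5) + fib (M + 3)) (M + 1) (by omega)
    (show _ < 2 * fib (M + 5) by omega)
  simp only [add_assoc, Nat.reduceAdd] at h
  have h' : maxD2 (fib (M + 5) + fib (M + 3)) ≤ fib (M + 5) := by omega
  obtain ⟨e, he, h3, h4⟩ := level_real (M + 1)
  simp only [add_assoc, Nat.reduceAdd] at h3 h4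
  obtain ⟨ha, ha1, ha2⟩ := alpha_facts
  generalize (1 + Real.sqrt 5) / 2 = α at *
  obtain ⟨he1, he2⟩ := abs_le.1 he
  have l1 : (maxD2 (fib (M + 5) + fib (M + 3)) : ℝ) ≤ fib (M + 5) := by exact_mod_cast h'
  refine l1.trans ?_
  have hpos : 0 < 4 * α + 3 := by linarith
  push_cast
  rw [← sub_le_iff_le_add, div_mul_eq_mul_div, le_div_iff₀ hpos, h4]
  have m3 : (α + 1) * e ≤ (α + 1) := by nlinarith
  have : (3 * α + 2) * (fib (M + 3) + (α * fib (M + 3) + e) + fib (M + 3)) -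
    (fib (M + 3) + (α * fib (M + 3) + e) - 10) * (4 * α + 3) =
      10 * (4 * α + 3) - (α + 1) * e := by
    linear_combination (-(fib (M + 3) : ℝ)) * ha
  nlinarith

/-- With `α = (1+√5)/2`:
`limsup (max_i D(2,i,n))/n = α/2 = (1+√5)/4` and
`liminf (max_i D(2,i,n))/n = (3α+2)/(4α+3)`. -/
theorem asymptotics_of_max_squares :
    Filter.limsup (fun n : ℕ => (maxD2 n : ℝ) / n) Filter.atTop = (1 + Real.sqrt 5) / 4 ∧
    Filter.liminf (fun n : ℕ => (maxD2 n : ℝ) / n) Filter.atTop =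
      (3 * ((1 + Real.sqrt 5) / 2) + 2) / (4 * ((1 + Real.sqrt 5) / 2) + 3) := by
  refine ⟨limsup_aux (fun n => (maxD2 n : ℝ)) _ 10 6 (fun n => Nat.cast_nonneg _) upper_real
      freq_sup,
    liminf_aux (fun n => (maxD2 n : ℝ)) _ 10 6 10 (fun n => Nat.cast_nonneg _) ?_ lower_real
      freq_inf⟩
  intro n hn
  have h1 := upper_real n (by omega)
  obtain ⟨_, _, h2⟩ := alpha_facts
  have h3 : (10 : ℝ) ≤ n := by exact_mod_cast hn
  nlinarith
end

section
/- Let α = (1+√5)/2. Then liminf_{n→∞} (min_{i≥1} D(2,i,n))/n = α/3 and limsup_{n→∞} (min_{i≥1} D(2,i,n))/n = (8−2α)/7, where D(2,i,n) is the number of distinct squares in F[i;n]. -/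
/-- The minimum over `i ≥ 1` of the number of distinct squares in `F[i;n]`. -/
noncomputable def minD2 (n : ℕ) : ℕ := sInf {d : ℕ | ∃ i, 1 ≤ i ∧ D2 i n = d}


/-- The inverse golden ratio. -/
noncomputable def th : ℝ := (Real.sqrt 5 - 1) / 2

lemma th_sq : th ^ 2 = 1 - th := by
  have h : Real.sqrt 5 ^ 2 = 5 := Real.sq_sqrt (by norm_num)
  unfold th; nlinarith

lemma th_lb : 0.618 < th := by
  have h : (2.236 : ℝ) < Real.sqrt 5 := by
    apply Real.lt_sqrt_of_sq_lt; norm_num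
  unfold th; linarith

lemma th_ub : th < 0.6181 := by
  have h : Real.sqrt 5 < (2.2362 : ℝ) := by
    rw [Real.sqrt_lt' (by norm_num)]; norm_num
  unfold th; linarith

lemma th_pos : 0 < th := by have := th_lb; linarith
lemma th_lt_one : th < 1 := by have := th_ub; linarith

lemma thp_pos (K : ℕ) : 0 < th ^ K := pow_pos th_pos K

lemma thp_rec (K : ℕ) : th ^ (K + 2) = th ^ K - th ^ (K + 1) := by
  have : th ^ (K + 2) = th ^ K * th ^ 2 := by ring
  rw [this, th_sq]; ring

/-- The sign `(-1)^K`. -/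
noncomputable def sg (K : ℕ) : ℝ := (-1) ^ K

lemma sg_succ (K : ℕ) : sg (K + 1) = - sg K := by unfold sg; ring

lemma sg_cases (K : ℕ) : sg K = 1 ∨ sg K = -1 := by
  unfold sg; exact neg_one_pow_eq_or ℝ K

lemma fib_th (K : ℕ) : (Nat.fib (K + 1) : ℝ) * th - Nat.fib K = sg K * th ^ (K + 1) := by
  induction K using Nat.twoStepInduction with
  | zero => simp [sg]
  | one => simp [sg]; have := th_sq; linarith
  | more k h1 h2 =>
    have e1 : (Nat.fib (k + 2 + 1) : ℝ) = Nat.fib (k + 1) + Nat.fib (k + 2) := by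
      exact_mod_cast Nat.fib_add_two (n := k + 1)
    have e2 : (Nat.fib (k + 2) : ℝ) = Nat.fib k + Nat.fib (k + 1) := by
      exact_mod_cast Nat.fib_add_two (n := k)
    have h3 := thp_rec (k + 1)
    have h4 : sg (k + 2) = sg k := by rw [sg_succ, sg_succ]; ring
    have h5 := sg_succ k
    rw [show k + 2 + 1 = k + 1 + 2 from rfl, h3, h4]
    rw [h5] at h2
    rw [show k + 1 + 2 = k + 2 + 1 from rfl, e1]
    rw [show k + 1 + 1 = k + 2 from rfl] at *
    have e3 : (Nat.fib (k+2) : ℝ) * th - Nat.fib (k+1) = -sg k * th ^ (k+2) := h2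
    rw [e2]
    rw [e2] at e3
    linear_combination h1 + e3

lemma lat (K : ℕ) : ∀ d c : ℤ, ∃ x y : ℤ, d = x * Nat.fib (K + 1) + y * Nat.fib K ∧
    |(d : ℝ) * th - c| = th ^ K * |(y : ℝ) - x * th| := by
  suffices h : ∀ d c : ℤ, ∃ x y : ℤ, d = x * Nat.fib (K + 1) + y * Nat.fib K ∧
      (d : ℝ) * th - c = - (sg K * th ^ K) * ((y : ℝ) - x * th) by
    intro d c
    obtain ⟨x, y, h1, h2⟩ := h d c
    refine ⟨x, y, h1, ?_⟩
    rw [h2, abs_mul, abs_neg, abs_mul, abs_of_pos (thp_pos K)]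
    rcases sg_cases K with h | h <;> rw [h] <;> simp
  induction K with
  | zero => intro d c; refine ⟨d, c, by simp, ?_⟩; simp [sg]
  | succ K ih =>
    intro d c
    obtain ⟨x, y, h1, h2⟩ := ih d c
    refine ⟨y, x - y, ?_, ?_⟩
    · rw [h1]; rw [show K + 1 + 1 = K + 2 from rfl, Nat.fib_add_two]; push_cast; ring
    · rw [h2, sg_succ]; push_cast
      have e : th ^ (K+1) * th = th ^ K - th ^ (K+1) := by rw [← thp_rec]; ring
      have e2 : th ^ (K+1) = th^K * th := by ring
      linear_combination (sg K * y) * e + (sg K * x - sg K * y+ sg K * y) * e2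

lemma apx1 (K : ℕ) (d : ℕ) (h0 : 0 < d) (h1 : d < Nat.fib (K + 2)) (c : ℤ) :
    th ^ (K + 1) ≤ |(d : ℝ) * th - c| := by
  obtain ⟨x, y, hd, ha⟩ := lat K d c
  have ha' : |(d : ℝ) * th - c| = th ^ K * |(y : ℝ) - x * th| := by exact_mod_cast ha
  rw [ha', pow_succ]
  apply mul_le_mul_of_nonneg_left _ (thp_pos K).le
  have hf : (Nat.fib (K + 2) : ℤ) = Nat.fib K + Nat.fib (K + 1) := by
    exact_mod_cast Nat.fib_add_two (n := K)
  have hA : (0:ℤ) ≤ Nat.fib K := by positivity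
  have hB : (0:ℤ) ≤ Nat.fib (K + 1) := by positivity
  have h0' : (0:ℤ) < d := by exact_mod_cast h0
  have h1' : (d:ℤ) < Nat.fib (K + 2) := by exact_mod_cast h1
  have t0 := th_pos
  have t1 := th_lt_one
  rcases lt_trichotomy x 0 with hx | hx | hx
  · have hy : 0 < y := by
      by_contra hy; push Not at hy; nlinarith
    have hx' : (x : ℝ) ≤ -1 := by exact_mod_cast (by omega : x ≤ -1)
    have hy' : (1 : ℝ) ≤ y := by exact_mod_cast hy
    apply le_trans _ (le_abs_self _); nlinarith
  · have hy : 0 < y := by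
      by_contra hy; push Not at hy; subst hx; nlinarith
    have hy' : (1 : ℝ) ≤ y := by exact_mod_cast hy
    apply le_trans _ (le_abs_self _); subst hx; push_cast; linarith
  · have hy : y ≤ 0 := by
      by_contra hy; push Not at hy; nlinarith
    have hx' : (1 : ℝ) ≤ x := by exact_mod_cast hx
    have hy' : (y : ℝ) ≤ 0 := by exact_mod_cast hy
    apply le_trans _ (neg_le_abs _); nlinarith

lemma apx2 (K : ℕ) (d : ℕ) (h0 : Nat.fib (K + 2) < d) (h1 : d < Nat.fib (K + 3)) (c : ℤ) :
    th ^ K ≤ |(d : ℝ) * th - c| := by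
  obtain ⟨x, y, hd, ha⟩ := lat (K + 1) d c
  have ha' : |(d : ℝ) * th - c| = th ^ (K + 1) * |(y : ℝ) - x * th| := by exact_mod_cast ha
  have t0 := th_pos
  have t1 := th_lt_one
  have key : 1 + th ≤ |(y : ℝ) - x * th| := by
    have hf : (Nat.fib (K + 3) : ℤ) = Nat.fib (K + 1) + Nat.fib (K + 2) := by
      exact_mod_cast Nat.fib_add_two (n := K + 1)
    have hA : (0:ℤ) < Nat.fib (K + 1) := by exact_mod_cast Nat.fib_pos.2 (Nat.succ_pos K)
    have hB : (Nat.fib (K + 1) : ℤ) ≤ Nat.fib (K + 2) := by exact_mod_cast Nat.fib_le_fib_succ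
    have h0' : (Nat.fib (K + 2) : ℤ) < d := by exact_mod_cast h0
    have h1' : (d:ℤ) < Nat.fib (K + 3) := by exact_mod_cast h1
    rw [show K + 1 + 1 = K + 2 from rfl] at hd
    rcases lt_trichotomy x 0 with hx | hx | hx
    · have hy : 0 < y := by
        by_contra hy; push Not at hy; nlinarith
      have hx' : (x : ℝ) ≤ -1 := by exact_mod_cast (by omega : x ≤ -1)
      have hy' : (1 : ℝ) ≤ y := by exact_mod_cast hy
      apply le_trans _ (le_abs_self _); nlinarith
    · have hy : 1 < y := by
        by_contra hy; push Not at hy; subst hx; nlinarith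
      have hy' : (2 : ℝ) ≤ y := by exact_mod_cast hy
      apply le_trans _ (le_abs_self _); subst hx; push_cast; linarith
    · have hy : y < 0 := by
        by_contra hy; push Not at hy
        rcases hy.lt_or_eq with hy | hy
        · nlinarith
        · subst hy
          have : 1 < x := by
            by_contra h; have : x = 1 := by omega
            subst this; omega
          nlinarith
      have hx' : (1 : ℝ) ≤ x := by exact_mod_cast hx
      have hy' : (y : ℝ) ≤ -1 := by exact_mod_cast (by omega : y ≤ -1)
      apply le_trans _ (neg_le_abs _); nlinarith
  rw [ha']
  have e : th ^ K = th ^ (K + 1) * (1 + th) := by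
    have := thp_rec K
    have e2 : th ^ (K+2) = th ^ (K+1) * th := by ring
    linarith
  rw [e]
  exact mul_le_mul_of_nonneg_left key (thp_pos _).le

/-- Hitting lemma. -/
lemma hit (m : ℕ) : ∀ (lo : ℝ) (J : ℕ), ∃ j, J ≤ j ∧ j < J + Nat.fib (m + 2) ∧
    ∃ c : ℤ, lo ≤ (j : ℝ) * th - c ∧ (j : ℝ) * th - c < lo + th ^ m := by
  induction m with
  | zero =>
    intro lo J
    refine ⟨J, le_rfl, by simp, ⌊(J:ℝ) * th - lo⌋, ?_, ?_⟩
    · have := Int.floor_le ((J:ℝ) * th - lo); linarith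
    · have := Int.lt_floor_add_one ((J:ℝ) * th - lo); simp; linarith
  | succ m ih =>
    intro lo J
    have hr := thp_rec m
    have hp := thp_pos (m + 2)
    have hp1 := thp_pos (m + 1)
    have hle : th ^ (m + 2) ≤ th ^ (m + 1) := by
      have := th_lt_one; rw [pow_succ th (m+1)]; nlinarith
    have hf := fib_th m
    have hfib : Nat.fib (m + 1 + 2) = Nat.fib (m + 1) + Nat.fib (m + 2) := Nat.fib_add_two
    rcases sg_cases m with hs | hs
    · -- shift moves right
      obtain ⟨j, h1, h2, c, h3, h4⟩ := ih (lo - th ^ (m + 2)) J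
      by_cases hc : lo ≤ (j : ℝ) * th - c
      · exact ⟨j, h1, by omega, c, hc, by linarith⟩
      · push Not at hc
        refine ⟨j + Nat.fib (m + 1), by omega, by omega, c + Nat.fib m, ?_, ?_⟩
        · push_cast; rw [hs] at hf; linarith
        · push_cast; rw [hs] at hf; linarith
    · obtain ⟨j, h1, h2, c, h3, h4⟩ := ih lo J
      by_cases hc : (j : ℝ) * th - c < lo + th ^ (m + 1)
      · exact ⟨j, h1, by omega, c, h3, hc⟩
      · push Not at hc
        refine ⟨j + Nat.fib (m + 1), by omega, by omega, c + Nat.fib m, ?_, ?_⟩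
        · push_cast; rw [hs] at hf; linarith
        · push_cast; rw [hs] at hf; linarith


lemma ne_int (d : ℕ) (hd : 0 < d) (c : ℤ) : (d : ℝ) * th - c ≠ 0 := by
  have h5 : d < Nat.fib (d + 3 + 2) := by
    have := Nat.le_fib_self (n := d + 5) (by omega)
    rw [show d + 3 + 2 = d + 5 from rfl]
    omega
  have h := apx1 (d + 3) d hd h5 c
  have h2 := thp_pos (d + 3 + 1)
  intro h0
  rw [h0, abs_zero] at h; linarith

/-- Crossing positions at level `K`. -/
def Z (K j : ℕ) : Prop :=
  ∃ c : ℤ, 0 < sg K * (((j + 1 : ℕ) : ℝ) * th - c) ∧ sg K * (((j + 1 : ℕ) : ℝ) * th - c) < th ^ K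

/-- Floor function of the rotation. -/
noncomputable def fl (j : ℕ) : ℤ := ⌊(j : ℝ) * th⌋

lemma fl_le (j : ℕ) : (fl j : ℝ) ≤ (j : ℝ) * th := Int.floor_le _
lemma lt_fl (j : ℕ) : (j : ℝ) * th < fl j + 1 := Int.lt_floor_add_one _
lemma fl_eq (j : ℕ) (c : ℤ) (h1 : (c : ℝ) ≤ (j : ℝ) * th) (h2 : (j : ℝ) * th < c + 1) : fl j = c :=
  Int.floor_eq_iff.2 ⟨h1, h2⟩

lemma fl_step (j : ℕ) : fl (j + 1) = fl j ∨ fl (j + 1) = fl j + 1 := by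
  have h1 := fl_le j
  have h2 := lt_fl j
  have t0 := th_pos
  have t1 := th_lt_one
  by_cases h : ((j + 1 : ℕ) : ℝ) * th < fl j + 1
  · left; exact fl_eq _ _ (by push_cast; linarith) h
  · right; push Not at h
    apply fl_eq
    · push_cast at *; linarith
    · push_cast at *; linarith

lemma thp_le_one (K : ℕ) : th ^ K ≤ 1 := pow_le_one₀ th_pos.le th_lt_one.le

lemma fib_th' (K : ℕ) :
    (Nat.fib (K + 1) : ℝ) * th - Nat.fib K = - sg (K + 1) * th ^ (K + 1) := by
  rw [fib_th, sg_succ]; ring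

lemma fl_shift_not (K j : ℕ) (h : ¬ Z (K + 1) j) :
    fl (j + 1 + Nat.fib (K + 1)) = fl (j + 1) + Nat.fib K := by
  have h1 := fl_le (j + 1)
  have h2 := lt_fl (j + 1)
  have hf := fib_th' K
  have hp := thp_pos (K + 1)
  have hn := ne_int (j + 1) (by omega)
  have hn2 := ne_int (j + 1 + Nat.fib (K + 1)) (by omega) (fl (j + 1) + 1 + Nat.fib K)
  unfold Z at h
  push Not at h
  push_cast at *
  rcases sg_cases (K + 1) with hs | hs <;> rw [hs] at hf h
  · have h3 := h (fl (j + 1)) (by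
      have := hn (fl (j+1)); rw [one_mul]; rcases lt_or_eq_of_le h1 with h | h
      · linarith
      · exfalso; apply this; linarith)
    apply fl_eq <;> push_cast <;> nlinarith
  · have h3 := h (fl (j + 1) + 1) (by push_cast; linarith)
    push_cast at h3
    apply fl_eq
    · push_cast; linarith
    · push_cast
      apply lt_of_le_of_ne
      · linarith
      · intro h; apply hn2; linarith

lemma fl_shift (K j : ℕ) (h : Z (K + 1) j) :
    (fl (j + 1 + Nat.fib (K + 1)) : ℝ) = fl (j + 1) + Nat.fib K - sg (K + 1) := by
  obtain ⟨c, h1, h2⟩ := h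
  have hf := fib_th' K
  have hp := thp_pos (K + 1)
  have hl := thp_le_one (K + 1)
  push_cast at *
  rcases sg_cases (K + 1) with hs | hs <;> rw [hs] at hf h1 h2 ⊢
  · have e1 : fl (j + 1) = c := by apply fl_eq <;> push_cast <;> linarith
    have e2 : fl (j + 1 + Nat.fib (K + 1)) = c + Nat.fib K - 1 := by
      apply fl_eq <;> push_cast <;> linarith
    rw [e1, e2]; push_cast; ring
  · have e1 : fl (j + 1) = c - 1 := by apply fl_eq <;> push_cast <;> linarith
    have e2 : fl (j + 1 + Nat.fib (K + 1)) = c + Nat.fib K := by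
      apply fl_eq <;> push_cast <;> linarith
    rw [e1, e2]; push_cast; ring

/-- The letter at position `j` computed from the rotation. -/
noncomputable def lett (j : ℕ) : Bool := decide (fl (j + 2) = fl (j + 1))

lemma lett_eq_iff (a b : ℕ) :
    lett a = lett b ↔ fl (a + 2) - fl (a + 1) = fl (b + 2) - fl (b + 1) := by
  unfold lett
  have h1 := fl_step (a + 1)
  have h2 := fl_step (b + 1)
  rw [decide_eq_decide]
  rw [show a + 1 + 1 = a + 2 from rfl] at h1
  rw [show b + 1 + 1 = b + 2 from rfl] at h2
  omega

lemma lett_shift (K j : ℕ) :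
    lett j = lett (j + Nat.fib (K + 1)) ↔ (Z (K + 1) j ↔ Z (K + 1) (j + 1)) := by
  rw [lett_eq_iff]
  have e1 : j + Nat.fib (K + 1) + 2 = j + 1 + 1 + Nat.fib (K + 1) := by ring
  have e2 : j + Nat.fib (K + 1) + 1 = j + 1 + Nat.fib (K + 1) := by ring
  rw [e1, e2]
  have hs : ∃ s : ℤ, (s : ℝ) = sg (K + 1) ∧ s ≠ 0 := by
    rcases sg_cases (K + 1) with hs | hs
    · exact ⟨1, by rw [hs]; simp, by norm_num⟩
    · exact ⟨-1, by rw [hs]; simp, by norm_num⟩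
  obtain ⟨s, hs, hs0⟩ := hs
  by_cases a : Z (K + 1) j <;> by_cases b : Z (K + 1) (j + 1) <;> simp only [a, b, iff_true, iff_false, not_true]
  · have h1 := fl_shift K j a
    have h2 := fl_shift K (j + 1) b
    rw [← hs] at h1 h2
    norm_cast at h1 h2
    rw [show j + 1 + 1 = j + 2 from rfl] at *
    omega
  · have h1 := fl_shift K j a
    have h2 := fl_shift_not K (j + 1) b
    rw [← hs] at h1
    norm_cast at h1
    rw [show j + 1 + 1 = j + 2 from rfl] at *
    omega
  · have h1 := fl_shift_not K j a
    have h2 := fl_shift K (j + 1) b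
    rw [← hs] at h2
    norm_cast at h2
    rw [show j + 1 + 1 = j + 2 from rfl] at *
    omega
  · have h1 := fl_shift_not K j a
    have h2 := fl_shift_not K (j + 1) b
    rw [show j + 1 + 1 = j + 2 from rfl] at *
    omega

lemma mism_far (m d : ℕ) (hfar : ∀ c : ℤ, th ^ m ≤ |(d : ℝ) * th - c|) (J : ℕ) :
    ∃ t, t < Nat.fib (m + 2) ∧ lett (J + t) ≠ lett (J + t + d) := by
  by_contra hcon
  push Not at hcon
  have hconst : ∀ t, t ≤ Nat.fib (m + 2) →
      fl (J + 1 + t + d) - fl (J + 1 + t) = fl (J + 1 + d) - fl (J + 1) := by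
    intro t
    induction t with
    | zero => intro _; simp
    | succ t ih =>
      intro ht
      have h1 := ih (by omega)
      have h2 := (lett_eq_iff _ _).1 (hcon t (by omega))
      have e1 : J + t + 2 = J + 1 + (t + 1) := by ring
      have e2 : J + t + 1 = J + 1 + t := by ring
      have e3 : J + t + d + 2 = J + 1 + (t + 1) + d := by ring
      have e4 : J + t + d + 1 = J + 1 + t + d := by ring
      rw [e1, e2, e3, e4] at h2
      omega
  have hd1 := fl_le d
  have hd2 := lt_fl d
  have f1 := hfar (fl d)
  rw [abs_of_nonneg (by linarith)] at f1
  have f2 := hfar (fl d + 1)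
  rw [abs_of_nonpos (by push_cast; linarith)] at f2
  push_cast at f2
  have hp := thp_pos m
  obtain ⟨j1, a1, a2, c1, a3, a4⟩ := hit m 0 (J + 1)
  obtain ⟨j2, b1, b2, c2, b3, b4⟩ := hit m (1 - ((d:ℝ) * th - fl d)) (J + 1)
  have k1 := hconst (j1 - (J + 1)) (by omega)
  have k2 := hconst (j2 - (J + 1)) (by omega)
  rw [show J + 1 + (j1 - (J + 1)) = j1 by omega] at k1
  rw [show J + 1 + (j2 - (J + 1)) = j2 by omega] at k2
  have e1 : fl j1 = c1 := by apply fl_eq <;> linarith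
  have e2 : fl (j1 + d) = c1 + fl d := by apply fl_eq <;> push_cast <;> linarith
  have e3 : fl j2 = c2 := by apply fl_eq <;> linarith
  have e4 : fl (j2 + d) = c2 + fl d + 1 := by apply fl_eq <;> push_cast <;> linarith
  omega

lemma Z_small (K j : ℕ) (h : j + 1 < Nat.fib (K + 2)) : ¬ Z (K + 1) j := by
  rintro ⟨c, h1, h2⟩
  have h3 := apx1 K (j + 1) (by omega) h c
  rcases sg_cases (K + 1) with hs | hs <;> rw [hs] at h1 h2
  · rw [abs_of_pos (by linarith)] at h3; linarith
  · rw [abs_of_neg (by linarith)] at h3; linarith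

lemma Fw_len (m : ℕ) : (Fw m).length = fn m := by
  induction m using Nat.twoStepInduction with
  | zero => rfl
  | one => rfl
  | more k h1 h2 =>
    rw [Fw, List.length_append, h1, h2]; unfold fn
    rw [show k + 2 + 2 = k + 2 + 2 from rfl, Nat.fib_add_two (n := k + 2)]; ring_nf

lemma Fw_lett (m : ℕ) : ∀ j, j < fn m → (Fw m).getD j false = lett j := by
  have t0 := th_lb
  have t1 := th_ub
  have f1 : fl 1 = 0 := by apply fl_eq <;> push_cast <;> linarith
  have f2 : fl 2 = 1 := by apply fl_eq <;> push_cast <;> linarith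
  have f3 : fl 3 = 1 := by apply fl_eq <;> push_cast <;> linarith
  induction m using Nat.twoStepInduction with
  | zero =>
    intro j hj
    have : j = 0 := by unfold fn at hj; simp at hj; exact hj
    subst this; simp [Fw, lett, f1, f2]
  | one =>
    intro j hj
    have : j = 0 ∨ j = 1 := by
      unfold fn at hj
      have : Nat.fib (1 + 2) = 2 := rfl
      omega
    rcases this with rfl | rfl <;> simp [Fw, lett, f1, f2, f3]
  | more k h1 h2 =>
    intro j hj
    rw [Fw]
    by_cases hlt : j < fn (k + 1)
    · rw [List.getD_append _ _ _ _ (by rw [Fw_len]; exact hlt)]; exact h2 j hlt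
    · push Not at hlt
      rw [List.getD_append_right _ _ _ _ (by rw [Fw_len]; exact hlt), Fw_len]
      obtain ⟨j', rfl⟩ := Nat.exists_eq_add_of_le hlt
      rw [Nat.add_sub_cancel_left]
      have hf : fn (k + 2) = fn (k + 1) + fn k := by
        unfold fn; rw [Nat.fib_add_two (n := k + 2)]; ring_nf
      rw [h1 j' (by omega)]
      unfold fn at *
      have hf1 : Nat.fib (k + 2 + 2) = Nat.fib (k + 2) + Nat.fib (k + 2 + 1) := Nat.fib_add_two
      have hf2 : Nat.fib (k + 2 + 1) = Nat.fib (k + 1) + Nat.fib (k + 2) := Nat.fib_add_two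
      have hf3 : 0 < Nat.fib (k + 1) := Nat.fib_pos.2 (by omega)
      have hj' : j' < Nat.fib (k + 2) := by
        rw [show k + 1 + 2 = k + 2 + 1 from rfl] at *; omega
      have := (lett_shift (k + 2) j').2 (by
        have n1 := Z_small (k + 2) j' (by omega)
        have n2 := Z_small (k + 2) (j' + 1) (by omega)
        simp [n1, n2])
      rw [this]; congr 1; ring_nf

lemma fibWord_eq (j : ℕ) : fibWord j = lett j := by
  unfold fibWord
  apply Fw_lett
  unfold fn
  have := Nat.le_fib_add_one (j + 3)
  have h1 : Nat.fib (j + 3) = Nat.fib (j + 1) + Nat.fib (j + 2) := Nat.fib_add_two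
  have h2 : 0 < Nat.fib (j + 1) := Nat.fib_pos.2 (by omega)
  rw [show j + 1 + 2 = j + 3 from rfl]
  omega


lemma thp_anti (K : ℕ) : th ^ (K + 1) < th ^ K := by
  have := th_lt_one
  have h := thp_pos K
  rw [pow_succ]; nlinarith

/-- Far shifts at level `K + 2`. -/
def Far (K d : ℕ) : Prop := ∀ c : ℤ, th ^ (K + 1) ≤ |(d : ℝ) * th - c|

lemma far1 (K d : ℕ) (h0 : 0 < d) (h1 : d < Nat.fib (K + 2)) : Far K d :=
  fun c => apx1 K d h0 h1 c

lemma far2 (K d : ℕ) (h0 : Nat.fib (K + 2) < d) (h1 : d < Nat.fib (K + 3)) : Far K d :=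
  fun c => le_trans (thp_anti K).le (apx2 K d h0 h1 c)

lemma far3 (K d : ℕ) (h0 : Nat.fib (K + 3) < d) (h1 : d < Nat.fib (K + 4)) : Far K d :=
  fun c => apx2 (K + 1) d h0 h1 c

lemma far4 (K d e : ℕ) (hd : d = Nat.fib (K + 4) + e)
    (h0 : Nat.fib (K + 2) < e) (h1 : e < Nat.fib (K + 3)) : Far K d := by
  intro c
  have h := apx2 K e h0 h1 (c - Nat.fib (K + 3))
  have hf := fib_th (K + 3)
  have e1 : (e : ℝ) * th - ((c - Nat.fib (K + 3) : ℤ) : ℝ)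
      = ((d : ℝ) * th - c) - sg (K + 3) * th ^ (K + 4) := by
    rw [hd]; push_cast; linear_combination -hf
  rw [e1] at h
  have h2 := abs_sub ((d : ℝ) * th - c) (sg (K + 3) * th ^ (K + 4))
  have h3 : |sg (K + 3) * th ^ (K + 4)| = th ^ (K + 4) := by
    rw [abs_mul, abs_of_pos (thp_pos _)]
    rcases sg_cases (K + 3) with hs | hs <;> rw [hs] <;> simp
  have r1 := thp_rec K
  have a1 := thp_anti (K + 2)
  have a2 := thp_anti (K + 3)
  rw [h3] at h2
  linarith

lemma mism (K d : ℕ) (h : Far K d) (J : ℕ) :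
    ∃ t, t < Nat.fib (K + 3) ∧ lett (J + t) ≠ lett (J + t + d) := mism_far (K + 1) d h J

lemma nonfib_mism (K d : ℕ) (h0 : Nat.fib (K + 2) < d) (h1 : d < Nat.fib (K + 3)) (J : ℕ) :
    ∃ t, t < d ∧ lett (J + t) ≠ lett (J + t + d) := by
  obtain ⟨t, ht, h⟩ := mism_far K d (apx2 K d h0 h1) J
  exact ⟨t, by omega, h⟩

lemma Z_spacing (K h z : ℕ) (hh : Z (K + 2) h) (hz : Z (K + 2) z) (hlt : h < z) :
    z = h + Nat.fib (K + 3) ∨ h + Nat.fib (K + 4) ≤ z := by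
  obtain ⟨c1, a1, a2⟩ := hh
  obtain ⟨c2, b1, b2⟩ := hz
  obtain ⟨d, rfl⟩ := Nat.exists_eq_add_of_lt hlt
  by_contra hcon
  push Not at hcon
  have key : |((d + 1 : ℕ) : ℝ) * th - ((c2 - c1 : ℤ) : ℝ)| < th ^ (K + 2) := by
    rw [abs_lt]
    push_cast at *
    rcases sg_cases (K + 2) with hs | hs <;> rw [hs] at a1 a2 b1 b2 <;> constructor <;> linarith
  rcases lt_trichotomy (d + 1) (Nat.fib (K + 3)) with h | h | h
  · have := apx1 (K + 1) (d + 1) (by omega) h (c2 - c1); linarith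
  · omega
  · have := apx2 (K + 1) (d + 1) h (by show d + 1 < Nat.fib (K + 4); omega) (c2 - c1)
    have := thp_anti (K + 1)
    linarith

lemma int_zero (n : ℤ) (h1 : (-1 : ℝ) < n) (h2 : (n : ℝ) < 1) : n = 0 := by
  have a : -1 < n := by exact_mod_cast h1
  have b : n < 1 := by exact_mod_cast h2
  omega

/-- Uniqueness of the integer in `Z`. -/
lemma Z_uniq (K j : ℕ) (h : Z K j) (c : ℤ) (h1 : 0 < sg K * (((j + 1 : ℕ) : ℝ) * th - c))
    (h2 : sg K * (((j + 1 : ℕ) : ℝ) * th - c) < 1) :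
    sg K * (((j + 1 : ℕ) : ℝ) * th - c) < th ^ K := by
  obtain ⟨c', a1, a2⟩ := h
  have hl := thp_le_one K
  have : c - c' = 0 := by
    apply int_zero <;> push_cast <;>
    rcases sg_cases K with hs | hs <;> rw [hs] at a1 a2 h1 h2 <;> linarith
  have : c = c' := by omega
  rw [this]; exact a2

lemma sg_sq (K : ℕ) : sg K * sg K = 1 := by
  rcases sg_cases K with hs | hs <;> rw [hs] <;> norm_num

lemma v_shift_up (K j : ℕ) (c : ℤ) :
    sg K * (((j + Nat.fib (K + 1) + 1 : ℕ) : ℝ) * th - ((c + Nat.fib K : ℤ) : ℝ))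
      = sg K * (((j + 1 : ℕ) : ℝ) * th - c) + th ^ (K + 1) := by
  have hf := fib_th K
  have hs := sg_sq K
  push_cast
  linear_combination sg K * hf + th ^ (K + 1) * hs

lemma v_shift_dn (K j : ℕ) (c : ℤ) :
    sg (K + 1) * (((j + Nat.fib (K + 1) + 1 : ℕ) : ℝ) * th - ((c + Nat.fib K : ℤ) : ℝ))
      = sg (K + 1) * (((j + 1 : ℕ) : ℝ) * th - c) - th ^ (K + 1) := by
  have := v_shift_up K j c
  rw [sg_succ]; linarith

lemma Z_double (K h : ℕ) (h0 : Z (K + 2) h) (h1 : Z (K + 2) (h + Nat.fib (K + 3))) :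
    ¬ Z (K + 2) (h + Nat.fib (K + 3) + Nat.fib (K + 3)) := by
  intro h2
  obtain ⟨c, a1, a2⟩ := h0
  have e1 := v_shift_up (K + 2) h c
  have e2 := v_shift_up (K + 2) (h + Nat.fib (K + 3)) (c + Nat.fib (K + 2))
  have p3 := thp_pos (K + 3)
  have r1 := thp_rec (K + 1)
  have r2 := thp_rec (K + 2)
  have r3 := thp_rec (K + 3)
  have p5 := thp_pos (K + 5)
  have hl := thp_le_one (K + 1)
  simp only [show K + 2 + 1 = K + 3 from rfl, show K + 1 + 2 = K + 3 from rfl,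
    show K + 1 + 1 = K + 2 from rfl, show K + 2 + 2 = K + 4 from rfl,
    show K + 3 + 2 = K + 5 from rfl, show K + 3 + 1 = K + 4 from rfl] at *
  have k1 := Z_uniq _ _ h1 _ (by rw [e1]; linarith) (by rw [e1]; linarith)
  rw [e1] at k1
  have k2 := Z_uniq _ _ h2 _ (by rw [e2, e1]; linarith) (by rw [e2, e1]; linarith)
  rw [e2, e1] at k2
  linarith

lemma Z_rel (K h z : ℕ) (hh : Z (K + 3) h) (hz : Z (K + 4) z) :
    z = h + Nat.fib (K + 3) ∨ h + Nat.fib (K + 5) ≤ z ∨ z + Nat.fib (K + 4) ≤ h := by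
  obtain ⟨c1, a1, a2⟩ := hh
  obtain ⟨c2, b1, b2⟩ := hz
  have hsg : sg (K + 4) = - sg (K + 3) := sg_succ (K + 3)
  rw [hsg] at b1 b2
  have r0 := thp_rec K
  have r1 := thp_rec (K + 1)
  have r2 := thp_rec (K + 2)
  have r3 := thp_rec (K + 3)
  have p5 := thp_pos (K + 5)
  have p4 := thp_pos (K + 4)
  have p0 := thp_pos (K + 2)
  have hl := thp_le_one K
  have hfp : 0 < Nat.fib (K + 3) := Nat.fib_pos.2 (by omega)
  simp only [Nat.add_assoc, Nat.reduceAdd] at r0 r1 r2 r3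
  by_contra hcon
  push Not at hcon
  obtain ⟨n1, n2, n3⟩ := hcon
  rcases lt_trichotomy h z with hlt | rfl | hlt
  · obtain ⟨d, rfl⟩ := Nat.exists_eq_add_of_lt hlt
    have key : |((d + 1 : ℕ) : ℝ) * th - ((c2 - c1 : ℤ) : ℝ)| < th ^ (K + 2) := by
      rw [abs_lt]
      push_cast at *
      rcases sg_cases (K + 3) with hs | hs <;> rw [hs] at a1 a2 b1 b2 <;> constructor <;> linarith
    have nf : ¬ Far (K + 1) (d + 1) := fun hf => by
      have := hf (c2 - c1); simp only [Nat.add_assoc, Nat.reduceAdd] at this; linarith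
    have hd : d + 1 = Nat.fib (K + 4) := by
      by_contra hne
      rcases lt_trichotomy (d + 1) (Nat.fib (K + 3)) with h' | h' | h'
      · exact nf (far1 _ _ (by omega) h')
      · omega
      · rcases lt_trichotomy (d + 1) (Nat.fib (K + 4)) with h'' | h'' | h''
        · exact nf (far2 _ _ h' h'')
        · omega
        · exact nf (far3 _ _ h'' (by show d + 1 < Nat.fib (K + 5); omega))
    have e1 := v_shift_up (K + 3) h c1
    rw [show h + d + 1 = h + Nat.fib (K + 3 + 1) by rw [show K + 3 + 1 = K + 4 from rfl]; omega] at b1 b2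
    have : c2 - (c1 + Nat.fib (K + 3)) = 0 := by
      simp only [Nat.add_assoc, Nat.reduceAdd] at *
      apply int_zero <;> push_cast at * <;>
      rcases sg_cases (K + 3) with hs | hs <;> rw [hs] at a1 a2 b1 b2 e1 <;> linarith
    have hc : c2 = c1 + Nat.fib (K + 3) := by omega
    rw [hc] at b1 b2
    simp only [Nat.add_assoc, Nat.reduceAdd] at *
    linarith
  · have : c2 - c1 = 0 := by
      apply int_zero <;> push_cast at * <;>
      rcases sg_cases (K + 3) with hs | hs <;> rw [hs] at a1 a2 b1 b2 <;> linarith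
    have hc : c2 = c1 := by omega
    rw [hc] at b1 b2
    linarith
  · obtain ⟨d, rfl⟩ := Nat.exists_eq_add_of_lt hlt
    have key : |((d + 1 : ℕ) : ℝ) * th - ((c1 - c2 : ℤ) : ℝ)| < th ^ (K + 2) := by
      rw [abs_lt]
      push_cast at *
      rcases sg_cases (K + 3) with hs | hs <;> rw [hs] at a1 a2 b1 b2 <;> constructor <;> linarith
    have nf : ¬ Far (K + 1) (d + 1) := fun hf => by
      have := hf (c1 - c2); simp only [Nat.add_assoc, Nat.reduceAdd] at this; linarith
    have hd : d + 1 = Nat.fib (K + 3) := by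
      by_contra hne
      rcases lt_trichotomy (d + 1) (Nat.fib (K + 3)) with h' | h' | h'
      · exact nf (far1 _ _ (by omega) h')
      · omega
      · exact nf (far2 _ _ h' (by show d + 1 < Nat.fib (K + 4); omega))
    have e1 := v_shift_dn (K + 2) z c2
    rw [show z + d + 1 = z + Nat.fib (K + 2 + 1) by rw [show K + 2 + 1 = K + 3 from rfl]; omega] at a1 a2
    have : c1 - (c2 + Nat.fib (K + 2)) = 0 := by
      simp only [Nat.add_assoc, Nat.reduceAdd] at *
      apply int_zero <;> push_cast at * <;>
      rcases sg_cases (K + 3) with hs | hs <;> rw [hs] at a1 a2 b1 b2 e1 <;> linarith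
    have hc : c1 = c2 + Nat.fib (K + 2) := by omega
    rw [hc] at a1 a2
    simp only [Nat.add_assoc, Nat.reduceAdd] at *
    linarith

lemma Z_sub (K l : ℕ) (h : Z (K + 4) l) : Z (K + 2) l ∧ Z (K + 2) (l + Nat.fib (K + 3)) := by
  obtain ⟨c, a1, a2⟩ := h
  have hsg : sg (K + 4) = sg (K + 2) := by rw [sg_succ (K+3), sg_succ (K+2)]; ring
  rw [hsg] at a1 a2
  have e1 := v_shift_up (K + 2) l c
  have r2 := thp_rec (K + 2)
  have p3 := thp_pos (K + 3)
  simp only [Nat.add_assoc, Nat.reduceAdd] at *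
  refine ⟨⟨c, a1, by linarith⟩, ⟨c + Nat.fib (K + 2), ?_, ?_⟩⟩
  · simp only [Nat.add_assoc]; linarith
  · simp only [Nat.add_assoc]; linarith

lemma Z_sub_conv (K l : ℕ) (h : Z (K + 2) l) (h' : Z (K + 2) (l + Nat.fib (K + 3))) :
    Z (K + 4) l := by
  obtain ⟨c, a1, a2⟩ := h
  have hsg : sg (K + 4) = sg (K + 2) := by rw [sg_succ (K+3), sg_succ (K+2)]; ring
  have e1 := v_shift_up (K + 2) l c
  have r1 := thp_rec (K + 1)
  have r2 := thp_rec (K + 2)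
  have p3 := thp_pos (K + 3)
  have hl := thp_le_one (K + 1)
  simp only [show K + 2 + 1 = K + 3 from rfl, show K + 1 + 2 = K + 3 from rfl,
    show K + 1 + 1 = K + 2 from rfl, show K + 2 + 2 = K + 4 from rfl] at *
  have k1 := Z_uniq _ _ h' _ (by rw [e1]; linarith) (by rw [e1]; linarith)
  rw [e1] at k1
  exact ⟨c, by rw [hsg]; exact a1, by rw [hsg]; linarith⟩

/-- `F[j .. j+2p)` is a square of period `p`. -/
def good (j p : ℕ) : Prop := ∀ t, t < p → lett (j + t) = lett (j + t + p)

lemma good_of (K j : ℕ) (h : ∀ z, j ≤ z → z ≤ j + Nat.fib (K + 1) → ¬ Z (K + 1) z) :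
    good j (Nat.fib (K + 1)) := by
  intro t ht
  rw [lett_shift]
  have n1 := h (j + t) (by omega) (by omega)
  have n2 := h (j + t + 1) (by omega) (by omega)
  simp [n1, n2]

lemma bad_of (K j z : ℕ) (h : Z (K + 2) z) (h1 : j ≤ z) (h2 : z ≤ j + Nat.fib (K + 2)) :
    ¬ good j (Nat.fib (K + 2)) := by
  intro hg
  have hp : 0 < Nat.fib (K + 2) := Nat.fib_pos.2 (by omega)
  have hp1 : 0 < Nat.fib (K + 1) := Nat.fib_pos.2 (by omega)
  have f3 : Nat.fib (K + 3) = Nat.fib (K + 1) + Nat.fib (K + 2) := Nat.fib_add_two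
  have f4 : Nat.fib (K + 4) = Nat.fib (K + 2) + Nat.fib (K + 3) := Nat.fib_add_two
  rcases Nat.lt_or_ge z (j + Nat.fib (K + 2)) with h3 | h3
  · have k := hg (z - j) (by omega)
    rw [show j + (z - j) = z by omega, lett_shift (K + 1)] at k
    have := Z_spacing K z (z + 1) h (k.1 h) (by omega)
    omega
  · have k := hg (Nat.fib (K + 2) - 1) (by omega)
    rw [show j + (Nat.fib (K + 2) - 1) = z - 1 by omega, lett_shift (K + 1)] at k
    rw [show z - 1 + 1 = z by omega] at k
    have := Z_spacing K (z - 1) z (k.2 h) h (by omega)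
    omega

/-- Existence of crossings. -/
lemma Z_exists (K J : ℕ) : ∃ z, J ≤ z ∧ Z K z := by
  have hp := thp_pos K
  rcases sg_cases K with hs | hs
  · obtain ⟨j, h1, h2, c, h3, h4⟩ := hit K 0 (J + 1)
    refine ⟨j - 1, by omega, c, ?_, ?_⟩
    · rw [hs, show j - 1 + 1 = j by omega]
      have := ne_int j (by omega) c
      rcases lt_or_eq_of_le h3 with h | h
      · linarith
      · exfalso; exact this h.symm
    · rw [hs, show j - 1 + 1 = j by omega]; linarith
  · obtain ⟨j, h1, h2, c, h3, h4⟩ := hit (K + 1) (- th ^ (K + 1)) (J + 1)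
    have := thp_anti K
    refine ⟨j - 1, by omega, c, ?_, ?_⟩
    · rw [hs, show j - 1 + 1 = j by omega]; linarith
    · rw [hs, show j - 1 + 1 = j by omega]; linarith

lemma Z_first (K i : ℕ) : ∃ z, i ≤ z ∧ Z K z ∧ ∀ y, i ≤ y → y < z → ¬ Z K y := by
  classical
  have h := Z_exists K i
  refine ⟨Nat.find h, (Nat.find_spec h).1, (Nat.find_spec h).2, ?_⟩
  intro y hy hlt hz
  exact Nat.find_min h hlt ⟨hy, hz⟩


/-- The factor of length `n` at (0-indexed) position `j`. -/
noncomputable def word (j n : ℕ) : List Bool := (List.range n).map (fun t => lett (j + t))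

lemma word_len (j n : ℕ) : (word j n).length = n := by simp [word]

lemma word_add (j a b : ℕ) : word j (a + b) = word j a ++ word (j + a) b := by
  simp [word, List.range_add, List.map_append, List.map_map, Function.comp_def, add_assoc]

lemma word_eq_iff (j k n : ℕ) : word j n = word k n ↔ ∀ t, t < n → lett (j + t) = lett (k + t) := by
  simp [word]

lemma fFactor_word (i n : ℕ) : fFactor (i + 1) n = word i n := by
  simp only [fFactor, word]
  apply List.map_congr_left
  intro t _
  rw [fibWord_eq]; rfl

lemma good_iff (j p : ℕ) : good j p ↔ word j p = word (j + p) p := by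
  rw [word_eq_iff]
  unfold good
  constructor
  · intro h t ht; rw [h t ht]; congr 1; omega
  · intro h t ht; rw [h t ht]; congr 1; omega

lemma square_iff (i n : ℕ) (w : List Bool) : (w ++ w) <:+: word i n ↔
    ∃ s, s + 2 * w.length ≤ n ∧ w = word (i + s) w.length ∧ good (i + s) w.length := by
  constructor
  · rintro ⟨s, t, h⟩
    have hl := congrArg List.length h
    simp only [List.length_append, word_len] at hl
    have hn : n = s.length + (w.length + w.length) + t.length := by omega
    rw [hn, word_add, word_add, word_add (i + s.length) w.length w.length] at h
    have h1 := List.append_inj h (by simp [word_len])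
    have h2 := List.append_inj h1.1 (by simp [word_len])
    have h3 := List.append_inj h2.2 (by simp [word_len])
    refine ⟨s.length, by omega, h3.1, ?_⟩
    rw [good_iff, ← h3.1]; exact h3.2
  · rintro ⟨s, h1, h2, h3⟩
    rw [good_iff] at h3
    refine ⟨word i s, word (i + s + (w.length + w.length)) (n - s - 2 * w.length), ?_⟩
    have hn : n = s + (w.length + w.length) + (n - s - 2 * w.length) := by omega
    have : word i n = word i s ++ (word (i + s) w.length ++ word (i + s + w.length) w.length)
      ++ word (i + s + (w.length + w.length)) (n - s - 2 * w.length) := by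
      conv_lhs => rw [hn]
      rw [word_add, word_add, word_add (i + s) w.length w.length]
      congr 2; omega
    rw [this, ← h3, ← h2]

open Classical in
/-- Roots of squares of period `p` in the factor at `i` of length `n`. -/
noncomputable def Sfin (i n p : ℕ) : Finset (List Bool) :=
  ((Finset.range (n + 1 - 2 * p)).filter (fun s => good (i + s) p)).image (fun s => word (i + s) p)

lemma mem_Sfin (i n p : ℕ) (hp : 0 < p) (w : List Bool) : w ∈ Sfin i n p ↔
    ∃ s, s + 2 * p ≤ n ∧ w = word (i + s) p ∧ good (i + s) p := by
  simp only [Sfin, Finset.mem_image, Finset.mem_filter, Finset.mem_range]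
  constructor
  · rintro ⟨s, ⟨h1, h2⟩, h3⟩; exact ⟨s, by omega, h3.symm, h2⟩
  · rintro ⟨s, h1, h2, h3⟩; exact ⟨s, ⟨by omega, h3⟩, h2.symm⟩

lemma Sfin_len (i n p : ℕ) (hp : 0 < p) (w : List Bool) (h : w ∈ Sfin i n p) : w.length = p := by
  rw [mem_Sfin _ _ _ hp] at h
  obtain ⟨s, _, h, _⟩ := h
  rw [h, word_len]

lemma D2_set (i n : ℕ) : {w : List Bool | w ≠ [] ∧ (w ++ w) <:+: fFactor (i + 1) n} =
    (((Finset.Icc 1 n).biUnion (Sfin i n) : Finset (List Bool)) : Set (List Bool)) := by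
  ext w
  simp only [Set.mem_ofPred_eq, fFactor_word, Finset.coe_biUnion, Set.mem_iUnion, Finset.mem_coe,
    Finset.mem_Icc, exists_prop]
  constructor
  · rintro ⟨h1, h2⟩
    have hl : 0 < w.length := List.length_pos_iff.2 h1
    rw [square_iff] at h2
    have : w.length ≤ n := by obtain ⟨s, h, _⟩ := h2; omega
    exact ⟨w.length, ⟨hl, this⟩, (mem_Sfin _ _ _ hl _).2 h2⟩
  · rintro ⟨p, ⟨hp, _⟩, h⟩
    have hl := Sfin_len _ _ _ hp _ h
    rw [mem_Sfin _ _ _ hp] at h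
    rw [← hl] at h hp
    exact ⟨List.length_pos_iff.1 hp, (square_iff _ _ _).2 h⟩

lemma D2_eq_s16 (i n : ℕ) : D2 (i + 1) n = ∑ p ∈ Finset.Icc 1 n, (Sfin i n p).card := by
  unfold D2
  rw [D2_set, Set.ncard_coe_finset, Finset.card_biUnion]
  intro p hp q hq hne
  rw [Finset.mem_coe, Finset.mem_Icc] at hp hq
  rw [Function.onFun, Finset.disjoint_left]
  intro w h1 h2
  exact hne ((Sfin_len _ _ _ (by omega) _ h1).symm.trans (Sfin_len _ _ _ (by omega) _ h2))

/-- Count at level `K`: period `fib (K+2)`. -/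
noncomputable def DD (i n K : ℕ) : ℕ := (Sfin i n (Nat.fib (K + 2))).card

lemma fib2_inj : Function.Injective (fun k => Nat.fib (k + 2)) :=
  Nat.fib_add_two_strictMono.injective

lemma D2_ge (i n K : ℕ) : ∑ k ∈ Finset.range K, DD i n k ≤ D2 (i + 1) n := by
  rw [D2_eq_s16]
  have h0 : ∀ p, n < p → (Sfin i n p).card = 0 := by
    intro p hp
    rw [Sfin, show n + 1 - 2 * p = 0 by omega]; simp
  calc ∑ k ∈ Finset.range K, DD i n k
      = ∑ p ∈ (Finset.range K).image (fun k => Nat.fib (k + 2)), (Sfin i n p).card := by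
        rw [Finset.sum_image (fun a _ b _ h => fib2_inj h)]; rfl
    _ ≤ ∑ p ∈ Finset.Icc 1 (n + Nat.fib (K + 2)), (Sfin i n p).card := by
        apply Finset.sum_le_sum_of_subset
        intro p hp
        rw [Finset.mem_image] at hp
        obtain ⟨k, hk, rfl⟩ := hp
        rw [Finset.mem_range] at hk
        rw [Finset.mem_Icc]
        have h1 : 0 < Nat.fib (k + 2) := Nat.fib_pos.2 (by omega)
        have h2 : Nat.fib (k + 2) ≤ Nat.fib (K + 2) := Nat.fib_mono (by omega)
        omega
    _ = ∑ p ∈ Finset.Icc 1 n, (Sfin i n p).card := by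
        symm
        apply Finset.sum_subset
        · intro p hp; rw [Finset.mem_Icc] at *; omega
        · intro p hp hp'
          rw [Finset.mem_Icc] at *
          exact h0 p (by omega)

lemma fib_bracket (p : ℕ) (hp : 0 < p) : ∃ k, Nat.fib (k + 2) ≤ p ∧ p < Nat.fib (k + 3) := by
  classical
  have hex : ∃ k, p < Nat.fib (k + 3) := by
    refine ⟨p, ?_⟩
    have := Nat.le_fib_add_one (p + 3)
    have h3 : p + 2 ≤ Nat.fib (p + 3) := by omega
    omega
  refine ⟨Nat.find hex, ?_, Nat.find_spec hex⟩
  rcases hk : Nat.find hex with _ | k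
  · simp; omega
  · have := Nat.find_min hex (show k < Nat.find hex by omega)
    push Not at this
    exact this

lemma D2_le (i n K : ℕ) (hn : n < 2 * Nat.fib (K + 2)) :
    D2 (i + 1) n ≤ ∑ k ∈ Finset.range K, DD i n k := by
  rw [D2_eq_s16]
  have h0 : ∀ p, n < 2 * p → (Sfin i n p).card = 0 := by
    intro p hp
    rw [Sfin, show n + 1 - 2 * p = 0 by omega]; simp
  calc ∑ p ∈ Finset.Icc 1 n, (Sfin i n p).card
      ≤ ∑ p ∈ (Finset.range K).image (fun k => Nat.fib (k + 2)), (Sfin i n p).card := by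
        apply Finset.sum_le_sum_of_ne_zero
        intro p hp hne
        rw [Finset.mem_Icc] at hp
        obtain ⟨k, h1, h2⟩ := fib_bracket p (by omega)
        rw [Finset.mem_image]
        have hpn : ¬ n < 2 * p := fun h => hne (h0 p h)
        refine ⟨k, ?_, ?_⟩
        · rw [Finset.mem_range]
          by_contra hk
          have : Nat.fib (K + 2) ≤ Nat.fib (k + 2) := Nat.fib_mono (by omega)
          omega
        · by_contra hpk
          apply hne
          rw [Finset.card_eq_zero, Finset.eq_empty_iff_forall_notMem]
          intro w hw
          rw [mem_Sfin _ _ _ (by omega)] at hw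
          obtain ⟨s, _, _, hg⟩ := hw
          obtain ⟨t, ht, hne2⟩ := nonfib_mism k p (by omega) h2 (i + s)
          exact hne2 (hg t ht)
    _ = ∑ k ∈ Finset.range K, DD i n k := by
        rw [Finset.sum_image (fun a _ b _ h => fib2_inj h)]; rfl

lemma Sfin_card_le (i n p : ℕ) (T : Finset ℕ) (hp : 0 < p)
    (hT : ∀ s, s + 2 * p ≤ n → good (i + s) p → ∃ j ∈ T, word (i + s) p = word j p) :
    (Sfin i n p).card ≤ T.card := by
  have : Sfin i n p ⊆ T.image (fun j => word j p) := by
    intro w hw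
    rw [mem_Sfin _ _ _ hp] at hw
    obtain ⟨s, h1, h2, h3⟩ := hw
    obtain ⟨j, hj, he⟩ := hT s h1 h3
    rw [Finset.mem_image]
    exact ⟨j, hj, by rw [h2, he]⟩
  exact (Finset.card_le_card this).trans Finset.card_image_le

lemma Sfin_card_ge (i n K : ℕ) (T : Finset ℕ)
    (hT : ∀ j ∈ T, i ≤ j ∧ j + 2 * Nat.fib (K + 2) ≤ i + n ∧ good j (Nat.fib (K + 2)))
    (hF : ∀ j ∈ T, ∀ j' ∈ T, j < j' → Far K (j' - j)) :
    T.card ≤ DD i n K := by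
  have hp : 0 < Nat.fib (K + 2) := Nat.fib_pos.2 (by omega)
  have hinj : Set.InjOn (fun j => word j (Nat.fib (K + 2))) (T : Set ℕ) := by
    have key : ∀ j ∈ T, ∀ j' ∈ T, j < j' →
        word j (Nat.fib (K + 2)) ≠ word j' (Nat.fib (K + 2)) := by
      intro j hj j' hj' hlt he
      obtain ⟨t, ht, hne⟩ := mism K _ (hF j hj j' hj' hlt) j
      have f3 : Nat.fib (K + 3) = Nat.fib (K + 1) + Nat.fib (K + 2) := Nat.fib_add_two
      have f1 : Nat.fib (K + 1) ≤ Nat.fib (K + 2) := Nat.fib_mono (by omega)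
      rw [word_eq_iff] at he
      apply hne
      have g1 := (hT j hj).2.2
      have g2 := (hT j' hj').2.2
      rw [show j + t + (j' - j) = j' + t by omega]
      by_cases htp : t < Nat.fib (K + 2)
      · exact he t htp
      · have e1 := g1 (t - Nat.fib (K + 2)) (by omega)
        have e2 := g2 (t - Nat.fib (K + 2)) (by omega)
        have e3 := he (t - Nat.fib (K + 2)) (by omega)
        rw [show j + (t - Nat.fib (K + 2)) + Nat.fib (K + 2) = j + t by omega] at e1
        rw [show j' + (t - Nat.fib (K + 2)) + Nat.fib (K + 2) = j' + t by omega] at e2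
        rw [← e1, ← e2, e3]
    intro j hj j' hj' he
    rcases lt_trichotomy j j' with h | h | h
    · exact absurd he (key j hj j' hj' h)
    · exact h
    · exact absurd he.symm (key j' hj' j hj h)
  rw [← Finset.card_image_of_injOn hinj]
  apply Finset.card_le_card
  intro w hw
  rw [Finset.mem_image] at hw
  obtain ⟨j, hj, rfl⟩ := hw
  rw [mem_Sfin _ _ _ hp]
  obtain ⟨h1, h2, h3⟩ := hT j hj
  exact ⟨j - i, by omega, by rw [show i + (j - i) = j by omega],
    by rw [show i + (j - i) = j by omega]; exact h3⟩

/-- Complexity bound. -/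
lemma rank_word (N j j' : ℕ)
    (h : ((Finset.Icc 1 N).filter (fun t => fl (j + 1 + t) - fl (j + 1) = fl t + 1)).card =
      ((Finset.Icc 1 N).filter (fun t => fl (j' + 1 + t) - fl (j' + 1) = fl t + 1)).card)
    (hle : (((j + 1 : ℕ) : ℝ) * th - fl (j + 1)) ≤ (((j' + 1 : ℕ) : ℝ) * th - fl (j' + 1))) :
    word j N = word j' N := by
  have two : ∀ a t : ℕ, fl (a + t) - fl a = fl t ∨ fl (a + t) - fl a = fl t + 1 := by
    intro a t
    have a1 := fl_le (a + t); have a2 := lt_fl (a + t)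
    have b1 := fl_le a; have b2 := lt_fl a
    have c1 := fl_le t; have c2 := lt_fl t
    push_cast at a1 a2
    have h1 : ((fl (a + t) - fl a - fl t : ℤ) : ℝ) < 2 := by push_cast; linarith
    have h2 : (-1 : ℝ) < ((fl (a + t) - fl a - fl t : ℤ) : ℝ) := by push_cast; linarith
    have h1' : fl (a + t) - fl a - fl t < 2 := by exact_mod_cast h1
    have h2' : -1 < fl (a + t) - fl a - fl t := by exact_mod_cast h2
    omega
  have hsub : (Finset.Icc 1 N).filter (fun t => fl (j + 1 + t) - fl (j + 1) = fl t + 1) ⊆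
      (Finset.Icc 1 N).filter (fun t => fl (j' + 1 + t) - fl (j' + 1) = fl t + 1) := by
    intro t ht
    rw [Finset.mem_filter] at ht ⊢
    refine ⟨ht.1, ?_⟩
    rcases two (j' + 1) t with h1 | h1
    · exfalso
      have a1 := fl_le (j + 1 + t)
      have a2 := lt_fl (j' + 1 + t)
      have e1 : (fl (j + 1 + t) : ℝ) = fl (j + 1) + fl t + 1 := by
        have := ht.2
        have h3 : fl (j + 1 + t) = fl (j + 1) + fl t + 1 := by omega
        rw [h3]; push_cast; ring
      have e2 : (fl (j' + 1 + t) : ℝ) = fl (j' + 1) + fl t := by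
        have h3 : fl (j' + 1 + t) = fl (j' + 1) + fl t := by omega
        rw [h3]; push_cast; ring
      rw [e1] at a1; rw [e2] at a2
      push_cast at *
      linarith
    · exact h1
  have heq := Finset.eq_of_subset_of_card_le hsub h.ge
  have all : ∀ t, t ≤ N → fl (j + 1 + t) - fl (j + 1) = fl (j' + 1 + t) - fl (j' + 1) := by
    intro t ht
    rcases Nat.eq_zero_or_pos t with h0 | h0
    · subst h0; simp
    · have m1 : t ∈ (Finset.Icc 1 N).filter (fun t => fl (j + 1 + t) - fl (j + 1) = fl t + 1) ↔
          t ∈ (Finset.Icc 1 N).filter (fun t => fl (j' + 1 + t) - fl (j' + 1) = fl t + 1) := by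
        rw [heq]
      simp only [Finset.mem_filter, Finset.mem_Icc] at m1
      rcases two (j + 1) t with h1 | h1 <;> rcases two (j' + 1) t with h2 | h2
      · omega
      · have := (m1.2 ⟨⟨h0, ht⟩, h2⟩).2; omega
      · have := (m1.1 ⟨⟨h0, ht⟩, h1⟩).2; omega
      · omega
  rw [word_eq_iff]
  intro t ht
  rw [lett_eq_iff]
  have e1 := all t (by omega)
  have e2 := all (t + 1) (by omega)
  rw [show j + 1 + t = j + t + 1 by omega, show j' + 1 + t = j' + t + 1 by omega] at e1
  rw [show j + 1 + (t + 1) = j + t + 2 by omega, show j' + 1 + (t + 1) = j' + t + 2 by omega] at e2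
  omega

lemma complexity (i n p : ℕ) (hp : 0 < p) : (Sfin i n p).card ≤ p + 1 := by
  classical
  let r : ℕ → ℕ := fun j =>
    ((Finset.Icc 1 p).filter (fun t => fl (j + 1 + t) - fl (j + 1) = fl t + 1)).card
  have hr : ∀ j j', r j = r j' → word j p = word j' p := by
    intro j j' h
    rcases le_total (((j + 1 : ℕ) : ℝ) * th - fl (j + 1)) (((j' + 1 : ℕ) : ℝ) * th - fl (j' + 1))
      with hle | hle
    · exact rank_word p j j' h hle
    · exact (rank_word p j' j h.symm hle).symm
  have hb : ∀ j, r j ≤ p := by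
    intro j
    refine (Finset.card_filter_le _ _).trans ?_
    simp
  let pick : ℕ → ℕ := fun x => if h : ∃ j, r j = x then h.choose else 0
  have hpick : ∀ j, r (pick (r j)) = r j := by
    intro j
    have h : ∃ j', r j' = r j := ⟨j, rfl⟩
    simp only [pick, dif_pos h]
    exact h.choose_spec
  refine (Sfin_card_le i n p ((Finset.range (p + 1)).image pick) hp ?_).trans ?_
  · intro s _ _
    refine ⟨pick (r (i + s)), ?_, hr _ _ (hpick _).symm⟩
    rw [Finset.mem_image]
    exact ⟨r (i + s), by rw [Finset.mem_range]; have := hb (i + s); omega, rfl⟩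
  · exact Finset.card_image_le.trans (by simp)

lemma D2_mono (i n n' : ℕ) (h : n ≤ n') : D2 (i + 1) n ≤ D2 (i + 1) n' := by
  unfold D2
  apply Set.ncard_le_ncard
  · rintro w ⟨h1, h2⟩
    refine ⟨h1, h2.trans ?_⟩
    rw [fFactor_word, fFactor_word, show n' = n + (n' - n) by omega, word_add]
    exact (List.prefix_append _ _).isInfix
  · rw [D2_set]; exact Finset.finite_toSet _

lemma minD2_le (i n : ℕ) : minD2 n ≤ D2 (i + 1) n := Nat.sInf_le ⟨i + 1, by omega, rfl⟩

lemma minD2_att (n : ℕ) : ∃ i, D2 (i + 1) n = minD2 n := by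
  have hne : {d : ℕ | ∃ i, 1 ≤ i ∧ D2 i n = d}.Nonempty := ⟨_, 1, le_refl _, rfl⟩
  obtain ⟨i, h1, h2⟩ := Nat.sInf_mem hne
  refine ⟨i - 1, ?_⟩
  rw [show i - 1 + 1 = i by omega, h2]; rfl

lemma minD2_mono (n n' : ℕ) (h : n ≤ n') : minD2 n ≤ minD2 n' := by
  obtain ⟨i, hi⟩ := minD2_att n'
  rw [← hi]
  exact (minD2_le i n).trans (D2_mono i n n' h)


lemma far_ok (K d p q : ℕ) (hp : Nat.fib (K + 2) = p) (hq : Nat.fib (K + 3) = q)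
    (h : (0 < d ∧ d < p) ∨ (p < d ∧ d < q) ∨ (q < d ∧ d < q + p) ∨ (q + 2 * p < d ∧ d < p + 2 * q)) :
    Far K d := by
  subst hp hq
  have f4 : Nat.fib (K + 4) = Nat.fib (K + 2) + Nat.fib (K + 3) := Nat.fib_add_two
  rcases h with h | h | h | h
  · exact far1 K d h.1 h.2
  · exact far2 K d h.1 h.2
  · exact far3 K d h.1 (by omega)
  · exact far4 K d (d - Nat.fib (K + 4)) (by omega) (by omega) (by omega)

lemma LC1 (i n K p a x : ℕ) (hp : Nat.fib (K + 2) = p) (hx : x ≤ p) (ha : i ≤ a)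
    (hn : a + x + 2 * p ≤ i + n + 1) (hg : ∀ j, a ≤ j → j < a + x → good j p) :
    x ≤ DD i n K := by
  have h := Sfin_card_ge i n K (Finset.Ico a (a + x)) ?_ ?_
  · simpa using h
  · intro j hj
    rw [Finset.mem_Ico] at hj
    rw [hp]
    exact ⟨by omega, by omega, hg j hj.1 hj.2⟩
  · intro j hj j' hj' hlt
    rw [Finset.mem_Ico] at hj hj'
    exact far1 K _ (by omega) (by omega)

lemma LC3 (i n K p q a x b y c z : ℕ) (hp : Nat.fib (K + 2) = p) (hq : Nat.fib (K + 3) = q)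
    (hx : x ≤ p) (hy : y ≤ p) (hz : z ≤ p)
    (ha : i ≤ a) (hab : a + x ≤ b) (hbc : b + y ≤ c)
    (hn1 : b + y + 2 * p ≤ i + n + 1) (hn : z = 0 ∨ c + z + 2 * p ≤ i + n + 1)
    (hg : ∀ j, a ≤ j → j < a + x → good j p)
    (hg2 : ∀ j, b ≤ j → j < b + y → good j p)
    (hg3 : ∀ j, c ≤ j → j < c + z → good j p)
    (d1 : (a + x + p ≤ b ∧ b + y ≤ a + q) ∨ (a + x + q ≤ b ∧ b + y ≤ a + q + p))
    (d2 : z = 0 ∨ (b + y + q ≤ c ∧ c + z ≤ b + q + p))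
    (d3 : z = 0 ∨ (a + x + q + 2 * p ≤ c ∧ c + z ≤ a + p + 2 * q)) :
    x + y + z ≤ DD i n K := by
  classical
  have h := Sfin_card_ge i n K (Finset.Ico a (a + x) ∪ (Finset.Ico b (b + y) ∪ Finset.Ico c (c + z))) ?_ ?_
  · rw [Finset.card_union_of_disjoint, Finset.card_union_of_disjoint] at h
    · simp only [Nat.card_Ico] at h; omega
    · rw [Finset.disjoint_left]; intro j hj hj'
      rw [Finset.mem_Ico] at hj hj'; omega
    · rw [Finset.disjoint_left]; intro j hj hj'
      simp only [Finset.mem_union, Finset.mem_Ico] at hj hj'; omega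
  · intro j hj
    simp only [Finset.mem_union, Finset.mem_Ico] at hj
    rw [hp]
    rcases hj with hj | hj | hj
    · exact ⟨by omega, by omega, hg j hj.1 hj.2⟩
    · exact ⟨by omega, by omega, hg2 j hj.1 hj.2⟩
    · exact ⟨by omega, by omega, hg3 j hj.1 hj.2⟩
  · intro j hj j' hj' hlt
    simp only [Finset.mem_union, Finset.mem_Ico] at hj hj'
    apply far_ok K _ p q hp hq
    rcases hj with hj | hj | hj <;> rcases hj' with hj' | hj' | hj' <;> omega

lemma LC2 (i n K p q a x b y : ℕ) (hp : Nat.fib (K + 2) = p) (hq : Nat.fib (K + 3) = q)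
    (hx : x ≤ p) (hy : y ≤ p)
    (ha : i ≤ a) (hab : a + x ≤ b)
    (hn1 : b + y + 2 * p ≤ i + n + 1)
    (hg : ∀ j, a ≤ j → j < a + x → good j p)
    (hg2 : ∀ j, b ≤ j → j < b + y → good j p)
    (d1 : (a + x + p ≤ b ∧ b + y ≤ a + q) ∨ (a + x + q ≤ b ∧ b + y ≤ a + q + p)) :
    x + y ≤ DD i n K :=
  LC3 i n K p q a x b y (b + y) 0 hp hq hx hy (by omega) ha hab le_rfl hn1 (Or.inl rfl) hg hg2
    (fun j h1 h2 => by omega) d1 (Or.inl rfl) (Or.inl rfl)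

lemma good_free (K j p : ℕ) (hp : Nat.fib (K + 2) = p)
    (h : ∀ z, j ≤ z → z ≤ j + p → ¬ Z (K + 2) z) : good j p := by
  subst hp; exact good_of (K + 1) j h

lemma gapS (K h p q : ℕ) (hp : Nat.fib (K + 2) = p) (hq : Nat.fib (K + 3) = q) (hh : Z (K + 2) h)
    (j : ℕ) (h1 : h < j) (h2 : j + p < h + q) : good j p := by
  apply good_free K j p hp
  intro z z1 z2 hz
  have := Z_spacing K h z hh hz (by omega)
  have f4 : Nat.fib (K + 4) = Nat.fib (K + 2) + Nat.fib (K + 3) := Nat.fib_add_two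
  omega

lemma gapL (K h p q : ℕ) (hp : Nat.fib (K + 2) = p) (hq : Nat.fib (K + 3) = q) (hh : Z (K + 2) h)
    (hno : ¬ Z (K + 2) (h + q))
    (j : ℕ) (h1 : h < j) (h2 : j < h + q) : good j p := by
  apply good_free K j p hp
  intro z z1 z2 hz
  have := Z_spacing K h z hh hz (by omega)
  have f4 : Nat.fib (K + 4) = Nat.fib (K + 2) + Nat.fib (K + 3) := Nat.fib_add_two
  rcases this with h' | h'
  · rw [hq] at h'; rw [h'] at hz; exact hno hz
  · omega

lemma gapF (K i l p : ℕ) (hp : Nat.fib (K + 2) = p)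
    (hno : ∀ y, i ≤ y → y < l → ¬ Z (K + 2) y)
    (j : ℕ) (h1 : i ≤ j) (h2 : j + p < l) : good j p := by
  apply good_free K j p hp
  intro z z1 z2
  exact hno z (by omega) (by omega)

lemma low_level (i n K : ℕ) (hn : 3 * Nat.fib (K + 4) ≤ n) : Nat.fib (K + 2) ≤ DD i n K := by
  have f4 : Nat.fib (K + 4) = Nat.fib (K + 2) + Nat.fib (K + 3) := Nat.fib_add_two
  have f3 : Nat.fib (K + 3) = Nat.fib (K + 1) + Nat.fib (K + 2) := Nat.fib_add_two
  have f1 : 0 < Nat.fib (K + 1) := Nat.fib_pos.2 (by omega)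
  have f2 : 0 < Nat.fib (K + 2) := Nat.fib_pos.2 (by omega)
  obtain ⟨l, hl, hz, hno⟩ := Z_first (K + 2) i
  generalize hp : Nat.fib (K + 2) = p at *
  generalize hq : Nat.fib (K + 3) = q at *
  by_cases hg : i + 2 * p ≤ l
  · exact LC1 i n K p i p hp le_rfl le_rfl (by omega)
      (fun j h1 h2 => gapF K i l p hp hno j h1 (by omega))
  by_cases hl2 : Z (K + 2) (l + q)
  · have hdd := Z_double K l hz (by rw [hq]; exact hl2)
    rw [hq] at hdd
    exact LC1 i n K p (l + q + 1) p hp le_rfl (by omega) (by omega)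
      (fun j h1 h2 => gapL K (l + q) p q hp hq hl2 hdd j (by omega) (by omega))
  · exact LC1 i n K p (l + 1) p hp le_rfl (by omega) (by omega)
      (fun j h1 h2 => gapL K l p q hp hq hz hl2 j (by omega) (by omega))

lemma sum_fib2 (M : ℕ) : ∑ k ∈ Finset.range M, Nat.fib (k + 2) + 2 = Nat.fib (M + 3) := by
  induction M with
  | zero => simp [Nat.fib]
  | succ M ih =>
    rw [Finset.sum_range_succ]
    have f4 : Nat.fib (M + 1 + 3) = Nat.fib (M + 2) + Nat.fib (M + 3) := Nat.fib_add_two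
    omega

lemma D2_split (i n M : ℕ) (hn : 3 * Nat.fib (M + 3) ≤ n) :
    Nat.fib (M + 3) + DD i n M + DD i n (M + 1) + DD i n (M + 2) ≤ D2 (i + 1) n + 2 := by
  have h := D2_ge i n (M + 3)
  rw [Finset.sum_range_succ, Finset.sum_range_succ, Finset.sum_range_succ] at h
  have h2 : ∑ k ∈ Finset.range M, Nat.fib (k + 2) ≤ ∑ k ∈ Finset.range M, DD i n k := by
    apply Finset.sum_le_sum
    intro k hk
    rw [Finset.mem_range] at hk
    apply low_level
    have : Nat.fib (k + 4) ≤ Nat.fib (M + 3) := Nat.fib_mono (by omega)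
    omega
  have h3 := sum_fib2 M
  omega

lemma ratio (M : ℕ) : 618 * Nat.fib (M + 3) ≤ 1000 * Nat.fib (M + 2) + 1000 ∧
    1000 * Nat.fib (M + 2) ≤ 619 * Nat.fib (M + 3) + 1000 := by
  have h := fib_th (M + 2)
  have h1 : |(Nat.fib (M + 3) : ℝ) * th - Nat.fib (M + 2)| ≤ 1 := by
    rw [h, abs_mul]
    have : |sg (M + 2)| = 1 := by rcases sg_cases (M + 2) with hs | hs <;> rw [hs] <;> simp
    rw [this, one_mul, abs_of_pos (thp_pos _)]
    exact thp_le_one _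
  rw [abs_le] at h1
  have a := th_lb
  have b := th_ub
  have c : (0 : ℝ) ≤ Nat.fib (M + 3) := by positivity
  constructor
  · have : (618 : ℝ) * Nat.fib (M + 3) ≤ 1000 * Nat.fib (M + 2) + 1000 := by nlinarith
    exact_mod_cast this
  · have : (1000 : ℝ) * Nat.fib (M + 2) ≤ 619 * Nat.fib (M + 3) + 1000 := by nlinarith
    exact_mod_cast this


lemma N1 (i n t M u P : ℕ) (hu : Nat.fib (M + 2) = u) (hP : Nat.fib (M + 3) = P)
    (hn : n = 3 * P + t) (ht : 10 * t ≤ 9 * P + 10) (hbig : 1000 ≤ P) :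
    P ≤ DD i n (M + 1) + DD i n (M + 2) + 10 ∨
    (t ≤ DD i n (M + 1) + DD i n (M + 2) + 10 ∧
      2 * t + P ≤ DD i n (M + 1) + DD i n (M + 2) + 10 + 2 * u) := by
  have hr := ratio M
  have f4 : Nat.fib (M + 4) = P + u := by
    have : Nat.fib (M + 4) = Nat.fib (M + 2) + Nat.fib (M + 3) := Nat.fib_add_two
    omega
  have f5 : Nat.fib (M + 5) = 2 * P + u := by
    have : Nat.fib (M + 5) = Nat.fib (M + 3) + Nat.fib (M + 4) := Nat.fib_add_two
    omega
  rw [hu, hP] at hr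
  obtain ⟨h, hih, hz, hno⟩ := Z_first (M + 3) i
  have rel := fun z hz' => Z_rel M h z hz hz'
  rw [hP, f4, f5] at rel
  generalize hB : DD i n (M + 1) = B
  generalize hC : DD i n (M + 2) = C
  have B1 : ∀ a x, x ≤ P → i ≤ a → a + x + 2 * P ≤ i + n + 1 →
      (∀ j, a ≤ j → j < a + x → good j P) → x ≤ B := by
    intro a x h1 h2 h3 h4
    rw [← hB]; exact LC1 i n (M + 1) P a x hP h1 h2 h3 h4
  have C1 : ∀ a x, x ≤ P → i ≤ a → a + x + 2 * (P + u) ≤ i + n + 1 →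
      (∀ j, a ≤ j → j < a + x → good j (P + u)) → x ≤ C := by
    intro a x h1 h2 h3 h4
    rw [← hC]; exact LC1 i n (M + 2) (P + u) a x f4 (by omega) h2 h3 h4
  have CG : ∀ j, h < j + (P + u) → j + u < h → good j (P + u) := by
    intro j h1 h2
    apply good_free (M + 2) j (P + u) f4
    intro z z1 z2 hz'
    have := rel z hz'
    omega
  have BS : ∀ j, h < j → j < h + u → good j P := fun j h1 h2 =>
    gapS (M + 1) h P (P + u) hP f4 hz j h1 (by omega)
  have BF : ∀ j, i ≤ j → j + P < h → good j P := fun j h1 h2 => gapF (M + 1) i h P hP hno j h1 h2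
  by_cases ga : i + 2 * P ≤ h
  · left
    have := B1 i P le_rfl le_rfl (by omega) (fun j h1 h2 => BF j h1 (by omega))
    omega
  by_cases gb : i + P ≤ h
  · obtain ⟨L, hL⟩ : ∃ L, h = i + P + L := ⟨h - i - P, by omega⟩
    have b1 : L ≤ B := B1 i L (by omega) le_rfl (by omega) (fun j h1 h2 => BF j h1 (by omega))
    have b2 : L < u → L < t → min t (u - 1) ≤ B := by
      intro h1 h2
      have := LC2 i n (M + 1) P (P + u) i L (h + 1) (min (t - L) (u - 1 - L)) hP f4 (by omega)
        (by omega) le_rfl (by omega) (by omega) (fun j h1 h2 => BF j h1 (by omega))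
        (fun j h1 h2 => BS j (by omega) (by omega)) (by omega)
      omega
    have c1 : L < u → 2 * u < P + t → min (L + P - u) (P + t - 2 * u) ≤ C := by
      intro h1 h2
      exact C1 i _ (by omega) le_rfl (by omega) (fun j h1 h2 => CG j (by omega) (by omega))
    have c2 : u ≤ L → 2 * u < P + t → min (P - 1) (P + t - u - L) ≤ C := by
      intro h1 h2
      by_cases hx : P + t - 2 * u < L - u + 1
      · omega
      · have := C1 (i + (L - u) + 1) (min (P - 1) (P + t - 2 * u - (L - u))) (by omega)
          (by omega) (by omega) (fun j h1 h2 => CG j (by omega) (by omega))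
        omega
    rcases Nat.lt_or_ge L u with q1 | q1
    · rcases Nat.lt_or_ge (2 * u) (P + t) with q2 | q2
      · have := c1 q1 q2
        rcases Nat.lt_or_ge L t with q3 | q3
        · have := b2 q1 q3; omega
        · omega
      · rcases Nat.lt_or_ge L t with q3 | q3
        · have := b2 q1 q3; omega
        · omega
    · rcases Nat.lt_or_ge (2 * u) (P + t) with q2 | q2
      · have := c2 q1 q2
        omega
      · omega
  · obtain ⟨g, hg⟩ : ∃ g, h = i + g := ⟨h - i, by omega⟩
    by_cases hc : Z (M + 4) (h + P)
    · have hn2 : ¬ Z (M + 3) (h + (P + u)) := by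
        intro hh
        have := Z_rel M _ _ hh hc
        rw [hP, f4, f5] at this
        omega
      have b1 : min P (P + t - g) ≤ B := B1 (h + 1) _ (by omega) (by omega) (by omega)
        (fun j h1 h2 => gapL (M + 1) h P (P + u) hP f4 hz hn2 j (by omega) (by omega))
      have c1 : u < g → 2 * u < P + t → min (g - u) (P + t - 2 * u) ≤ C := by
        intro h1 h2
        exact C1 i _ (by omega) le_rfl (by omega) (fun j h1 h2 => CG j (by omega) (by omega))
      rcases Nat.lt_or_ge u g with q1 | q1
      · rcases Nat.lt_or_ge (2 * u) (P + t) with q2 | q2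
        · have := c1 q1 q2
          omega
        · omega
      · omega
    · have b1 : min (u - 1) (P + t - g) ≤ B := B1 (h + 1) _ (by omega) (by omega) (by omega)
        (fun j h1 h2 => BS j (by omega) (by omega))
      have c1 : 2 * u < P + t → P + t - 2 * u ≤ C := by
        intro h1
        refine C1 i _ (by omega) le_rfl (by omega) ?_
        intro j h1 h2
        apply good_free (M + 2) j (P + u) f4
        intro z z1 z2 hz'
        rcases rel z hz' with h3 | h3 | h3
        · rw [h3] at hz'; exact hc hz'
        · omega
        · omega
      rcases Nat.lt_or_ge (2 * u) (P + t) with q2 | q2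
      · have := c1 q2
        omega
      · omega

lemma N2 (i n t M u P : ℕ) (hu : Nat.fib (M + 2) = u) (hP : Nat.fib (M + 3) = P)
    (hn : n = 3 * P + t) (hbig : 1000 ≤ P) :
    (10 * t ≤ 6 * P → u ≤ DD i n M + 10 ∨ 2 * P ≤ DD i n M + DD i n (M + 1) + u + 10) ∧
    (9 * P ≤ 10 * t → 10 * t ≤ 9 * P + 10 → u ≤ DD i n M + 10) := by
  have hr := ratio M
  have f4 : Nat.fib (M + 4) = P + u := by
    have : Nat.fib (M + 4) = Nat.fib (M + 2) + Nat.fib (M + 3) := Nat.fib_add_two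
    omega
  have f5 : Nat.fib (M + 5) = 2 * P + u := by
    have : Nat.fib (M + 5) = Nat.fib (M + 3) + Nat.fib (M + 4) := Nat.fib_add_two
    omega
  rw [hu, hP] at hr
  obtain ⟨l, hil, hz, hno⟩ := Z_first (M + 2) i
  generalize hA : DD i n M = A
  generalize hB : DD i n (M + 1) = B
  have A1 : ∀ a x, x ≤ u → i ≤ a → a + x + 2 * u ≤ i + n + 1 →
      (∀ j, a ≤ j → j < a + x → good j u) → x ≤ A := by
    intro a x h1 h2 h3 h4
    rw [← hA]; exact LC1 i n M u a x hu h1 h2 h3 h4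
  have B1 : ∀ a x, x ≤ P → i ≤ a → a + x + 2 * P ≤ i + n + 1 →
      (∀ j, a ≤ j → j < a + x → good j P) → x ≤ B := by
    intro a x h1 h2 h3 h4
    rw [← hB]; exact LC1 i n (M + 1) P a x hP h1 h2 h3 h4
  have AF : ∀ j, i ≤ j → j + u < l → good j u := fun j h1 h2 => gapF M i l u hu hno j h1 h2
  by_cases ga : i + 2 * u ≤ l
  · have := A1 i u le_rfl le_rfl (by omega) (fun j h1 h2 => AF j h1 (by omega))
    omega
  obtain ⟨g, hg⟩ : ∃ g, l = i + g := ⟨l - i, by omega⟩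
  by_cases hl2 : Z (M + 2) (l + P)
  · have hl3 : ¬ Z (M + 2) (l + P + P) := by
      have := Z_double M l hz (by rw [hP]; exact hl2)
      rwa [hP] at this
    have hl4 : Z (M + 4) l := Z_sub_conv M l hz (by rw [hP]; exact hl2)
    have BG : ∀ j, l < j + P → j < l + u → good j P := by
      intro j h1 h2
      apply good_free (M + 1) j P hP
      intro z z1 z2 hz'
      have := Z_rel M z l hz' hl4
      rw [hP, f4, f5] at this
      omega
    have AS : ∀ j, l < j → j + u < l + P → good j u := fun j h1 h2 =>
      gapS M l u P hu hP hz j h1 h2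
    have AR : ∀ j, l + P < j → j < l + P + P → good j u := fun j h1 h2 =>
      gapL M (l + P) u P hu hP hl2 hl3 j h1 h2
    have a1 : P - u - 1 ≤ A := A1 (l + 1) _ (by omega) (by omega) (by omega)
      (fun j h1 h2 => AS j (by omega) (by omega))
    have a2 : min u (2 * P - 2 * u + t - g) ≤ A := by
      by_cases hx : 2 * P + t < 2 * u + g
      · omega
      · exact A1 (l + P + 1) _ (by omega) (by omega) (by omega)
          (fun j h1 h2 => AR j (by omega) (by omega))
    have a3 : g - u ≤ A := by
      by_cases hx : u < g
      · exact A1 i _ (by omega) (by omega) (by omega) (fun j h1 h2 => AF j (by omega) (by omega))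
      · omega
    constructor
    · intro ht
      rcases Nat.lt_or_ge P g with q1 | q1
      · have b1 : min P (2 * P + t - g) ≤ B + 1 := by
          have := B1 (i + (g - P) + 1) (min P (2 * P + t - g) - 1) (by omega) (by omega) (by omega)
            (fun j h1 h2 => BG j (by omega) (by omega))
          omega
        omega
      · have b1 : min (g + u) P - 2 ≤ B := B1 (i + 1) _ (by omega) (by omega) (by omega)
            (fun j h1 h2 => BG j (by omega) (by omega))
        omega
    · intro ht1 ht2
      by_cases hx : 2 * P + t < 3 * u + g
      · have := LC3 i n M u P i (g - P) (l + 1) (P - u - 1)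
          (l + P + (P - u) + 1) (min (P + t - u - g) (2 * u - 5 - g)) hu hP (by omega) (by omega) (by omega)
          le_rfl (by omega) (by omega) (by omega) (Or.inr (by omega))
          (fun j h1 h2 => AF j (by omega) (by omega))
          (fun j h1 h2 => AS j (by omega) (by omega))
          (fun j h1 h2 => AR j (by omega) (by omega))
          (Or.inr (by omega)) (Or.inr (by omega)) (by omega)
        omega
      · omega
  · have AL : ∀ j, l < j → j < l + P → good j u := fun j h1 h2 => gapL M l u P hu hP hz hl2 j h1 h2
    by_cases hx : g + 3 * u ≤ 3 * P + t
    · have := A1 (l + 1) u le_rfl (by omega) (by omega)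
        (fun j h1 h2 => AL j (by omega) (by omega))
      omega
    · have := LC2 i n M u P i (g - P) (l + 1) (P + u - g - 5) hu hP (by omega) (by omega) le_rfl
        (by omega) (by omega) (fun j h1 h2 => AF j (by omega) (by omega))
        (fun j h1 h2 => AL j (by omega) (by omega)) (by omega)
      omega


lemma lowerF (n t M u P : ℕ) (hu : Nat.fib (M + 2) = u) (hP : Nat.fib (M + 3) = P)
    (hn : n = 3 * P + t) (hbig : 1000 ≤ P) :
    (2 * t ≤ P → P + u + t ≤ minD2 n + 40) ∧
    (2 * t ≤ P → P ≤ 2 * t + 1 → 3 * P ≤ minD2 n + u + 40) ∧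
    (9 * P ≤ 10 * t → 10 * t ≤ 9 * P + 10 → 2 * P + u ≤ minD2 n + 40) := by
  obtain ⟨i, hi⟩ := minD2_att n
  rw [← hi]
  have hs := D2_split i n M (by omega)
  have h1 := N1 i n t M u P hu hP hn
  have h2 := N2 i n t M u P hu hP hn hbig
  have hr := ratio M
  rw [hu, hP] at hr
  rw [hP] at hs
  refine ⟨fun ht => ?_, fun ht ht' => ?_, fun ht ht' => ?_⟩
  · have a := h1 (by omega) hbig
    have b := h2.1 (by omega)
    omega
  · have a := h1 (by omega) hbig
    have b := h2.1 (by omega)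
    omega
  · have a := h1 (by omega) hbig
    have b := h2.2 (by omega) (by omega)
    omega


lemma DD_le (i n K : ℕ) : DD i n K ≤ Nat.fib (K + 2) + 1 :=
  complexity i n _ (Nat.fib_pos.2 (by omega))

lemma DD_sum_le (i n M : ℕ) : ∑ k ∈ Finset.range M, DD i n k + 2 ≤ Nat.fib (M + 3) + M := by
  have h : ∑ k ∈ Finset.range M, DD i n k ≤ ∑ k ∈ Finset.range M, (Nat.fib (k + 2) + 1) :=
    Finset.sum_le_sum (fun k _ => DD_le i n k)
  rw [Finset.sum_add_distrib] at h
  simp only [Finset.sum_const, Finset.card_range, smul_eq_mul, mul_one] at h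
  have := sum_fib2 M
  omega

lemma DD_le_window (i n K : ℕ) : DD i n K ≤ n + 1 - 2 * Nat.fib (K + 2) := by
  unfold DD
  refine (Sfin_card_le i n _ (Finset.Ico i (i + (n + 1 - 2 * Nat.fib (K + 2))))
    (Nat.fib_pos.2 (by omega)) ?_).trans (by simp)
  intro s hs _
  exact ⟨i + s, by rw [Finset.mem_Ico]; omega, rfl⟩

lemma UA (n t M u P : ℕ) (hu : Nat.fib (M + 2) = u) (hP : Nat.fib (M + 3) = P)
    (hn : n = 3 * P + t) (ht : t < P + 2 * u) :
    minD2 n ≤ P + u + t + (P + t + 1 - 2 * u) + M := by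
  have f4 : Nat.fib (M + 4) = P + u := by
    have : Nat.fib (M + 4) = Nat.fib (M + 2) + Nat.fib (M + 3) := Nat.fib_add_two
    omega
  have f5 : Nat.fib (M + 5) = 2 * P + u := by
    have : Nat.fib (M + 5) = Nat.fib (M + 3) + Nat.fib (M + 4) := Nat.fib_add_two
    omega
  obtain ⟨h, hh, hz⟩ := Z_exists (M + 3) P
  refine (minD2_le (h - P) n).trans ((D2_le (h - P) n (M + 3) ?_).trans ?_)
  · show n < 2 * Nat.fib (M + 5)
    rw [f5]; omega
  rw [Finset.sum_range_succ, Finset.sum_range_succ]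
  have s1 : ∑ k ∈ Finset.range (M + 1), DD (h - P) n k + 2 ≤ Nat.fib (M + 4) + (M + 1) :=
    DD_sum_le (h - P) n (M + 1)
  have s2 : DD (h - P) n (M + 2) ≤ n + 1 - 2 * Nat.fib (M + 4) := DD_le_window (h - P) n (M + 2)
  have s3 : DD (h - P) n (M + 1) ≤ t := by
    have hp : 0 < P := by rw [← hP]; exact Nat.fib_pos.2 (by omega)
    unfold DD
    rw [show M + 1 + 2 = M + 3 by omega, hP]
    refine (Sfin_card_le (h - P) n P (Finset.Ico (h + 1) (h + 1 + t)) hp ?_).trans (by simp)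
    intro s hs hg
    refine ⟨h - P + s, ?_, rfl⟩
    rw [Finset.mem_Ico]
    have : P < s := by
      by_contra hc
      have := bad_of (M + 1) (h - P + s) h hz (by omega)
        (by show h ≤ h - P + s + Nat.fib (M + 3); rw [hP]; omega)
      apply this
      show good _ (Nat.fib (M + 3))
      rw [hP]; exact hg
    omega
  rw [f4] at s1 s2
  omega

lemma UB (n t M u P : ℕ) (hu : Nat.fib (M + 2) = u) (hP : Nat.fib (M + 3) = P)
    (hn : n = 3 * P + t) (ht : t ≤ 2 * u) (hbig : 1000 ≤ P) :
    minD2 n + u ≤ 3 * P + (t + 1 - u) + M + 1 := by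
  have hr := ratio M
  rw [hu, hP] at hr
  have f4 : Nat.fib (M + 4) = P + u := by
    have : Nat.fib (M + 4) = Nat.fib (M + 2) + Nat.fib (M + 3) := Nat.fib_add_two
    omega
  have f5 : Nat.fib (M + 5) = 2 * P + u := by
    have : Nat.fib (M + 5) = Nat.fib (M + 3) + Nat.fib (M + 4) := Nat.fib_add_two
    omega
  obtain ⟨l, hl, hz⟩ := Z_exists (M + 4) P
  obtain ⟨i, hi⟩ : ∃ i, l = i + P := ⟨l - P, by omega⟩
  have hD : D2 (i + 1) n ≤ ∑ k ∈ Finset.range (M + 3), DD i n k := by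
    apply D2_le
    show n < 2 * Nat.fib (M + 5)
    rw [f5]; omega
  have hm := minD2_le i n
  rw [Finset.sum_range_succ, Finset.sum_range_succ, Finset.sum_range_succ] at hD
  have s1 := DD_sum_le i n M
  have s2 : DD i n (M + 1) ≤ Nat.fib (M + 3) + 1 := DD_le i n (M + 1)
  have s3 : DD i n (M + 2) ≤ 0 := by
    unfold DD
    rw [show M + 2 + 2 = M + 4 by omega, f4]
    refine (Sfin_card_le i n (P + u) ∅ (by omega) ?_).trans (by simp)
    intro s hs hg
    exfalso
    have := bad_of (M + 2) (i + s) l hz (by omega)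
      (by show l ≤ i + s + Nat.fib (M + 4); rw [f4]; omega)
    apply this
    show good _ (Nat.fib (M + 4))
    rw [f4]; exact hg
  have per : ∀ j, l < j + P → j + u < l + P + u → word j u = word (j + P) u := by
    intro j h1 h2
    rw [word_eq_iff]
    intro x hx
    have hno : ∀ z, l < z + P → z < l + P + u → ¬ Z (M + 3) z := by
      intro z z1 z2 hz'
      have := Z_rel M z l hz' hz
      rw [hP, f4, f5] at this
      omega
    have hsh := lett_shift (M + 2) (j + x)
    have e : Nat.fib (M + 2 + 1) = P := hP
    rw [e] at hsh
    rw [show j + P + x = j + x + P by omega]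
    rw [hsh]
    have n1 := hno (j + x) (by omega) (by omega)
    have n2 := hno (j + x + 1) (by omega) (by omega)
    exact ⟨fun h => absurd h n1, fun h => absurd h n2⟩
  have s4 : DD i n M + u ≤ 1 + P + (t + 1 - u) := by
    obtain ⟨z1, z2⟩ := Z_sub M l hz
    rw [hP] at z2
    unfold DD
    rw [hu]
    have hc := Sfin_card_le i n u
      ({i} ∪ (Finset.Ico l (l + (P - u)) ∪
        Finset.Ico (l + 2 * P - u) (l + 2 * P - u + (t + 1 - u)))) (by omega) ?_
    · have c1 := Finset.card_union_le ({i} : Finset ℕ) (Finset.Ico l (l + (P - u)) ∪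
        Finset.Ico (l + 2 * P - u) (l + 2 * P - u + (t + 1 - u)))
      have c2 := Finset.card_union_le (Finset.Ico l (l + (P - u)))
        (Finset.Ico (l + 2 * P - u) (l + 2 * P - u + (t + 1 - u)))
      simp only [Finset.card_singleton, Nat.card_Ico] at c1 c2
      omega
    · intro s hs hg
      have b1 : ¬ (i + s ≤ l ∧ l ≤ i + s + u) := by
        rintro ⟨h1, h2⟩
        have := bad_of M (i + s) l z1 h1 (by rw [hu]; exact h2)
        rw [hu] at this
        exact this hg
      have b2 : ¬ (i + s ≤ l + P ∧ l + P ≤ i + s + u) := by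
        rintro ⟨h1, h2⟩
        have := bad_of M (i + s) (l + P) z2 h1 (by rw [hu]; exact h2)
        rw [hu] at this
        exact this hg
      simp only [Finset.mem_union, Finset.mem_singleton, Finset.mem_Ico]
      rcases Nat.eq_zero_or_pos s with h0 | h0
      · exact ⟨i, Or.inl rfl, by rw [h0, add_zero]⟩
      by_cases q1 : i + s ≤ l
      · exact ⟨i + s + P, Or.inr (Or.inl (by omega)), per _ (by omega) (by omega)⟩
      by_cases q2 : i + s ≤ l + P
      · exact ⟨i + s, Or.inr (Or.inl (by omega)), rfl⟩
      by_cases q3 : i + s + u < l + 2 * P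
      · refine ⟨i + s - P, Or.inr (Or.inl (by omega)), ?_⟩
        rw [per (i + s - P) (by omega) (by omega), show i + s - P + P = i + s by omega]
      · exact ⟨i + s, Or.inr (Or.inr (by omega)), rfl⟩
  rw [hP] at s1 s2
  omega


lemma u_real (M : ℕ) : |(Nat.fib (M + 2) : ℝ) - th * Nat.fib (M + 3)| ≤ 1 := by
  have h := fib_th (M + 2)
  have e : (Nat.fib (M + 2) : ℝ) - th * Nat.fib (M + 3) = -(sg (M + 2) * th ^ (M + 3)) := by
    rw [← h]; ring
  rw [e, abs_neg, abs_mul]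
  have : |sg (M + 2)| = 1 := by rcases sg_cases (M + 2) with hs | hs <;> rw [hs] <;> simp
  rw [this, one_mul, abs_of_pos (thp_pos _)]
  exact thp_le_one _

lemma sq_le_fib (k : ℕ) : k * k ≤ 4 * Nat.fib (k + 3) ∧ (k + 1) * (k + 1) ≤ 4 * Nat.fib (k + 4) := by
  induction k with
  | zero => simp [Nat.fib]
  | succ k ih =>
    refine ⟨ih.2, ?_⟩
    have f : Nat.fib (k + 1 + 4) = Nat.fib (k + 3) + Nat.fib (k + 4) := Nat.fib_add_two
    rw [f]
    rcases Nat.lt_or_ge k 3 with h | h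
    · interval_cases k <;> simp [Nat.fib]
    · nlinarith

lemma bracket (n : ℕ) (hn : 3 * Nat.fib 23 ≤ n) : ∃ M, 20 ≤ M ∧ 3 * Nat.fib (M + 3) ≤ n ∧
    n < 3 * Nat.fib (M + 4) := by
  classical
  have hex : ∃ k, n < 3 * Nat.fib (k + 4) := by
    refine ⟨n, ?_⟩
    have := Nat.le_fib_add_one (n + 4)
    omega
  refine ⟨Nat.find hex, ?_, ?_, Nat.find_spec hex⟩
  · by_contra hc
    have h1 := Nat.find_spec hex
    have : Nat.fib (Nat.find hex + 4) ≤ Nat.fib 23 := Nat.fib_mono (by omega)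
    omega
  · by_contra hc
    push Not at hc
    rcases hk : Nat.find hex with _ | k
    · rw [hk] at hc
      have : Nat.fib (0 + 3) ≤ Nat.fib 23 := Nat.fib_mono (by omega)
      omega
    · rw [hk] at hc
      exact Nat.find_min hex (show k < Nat.find hex by omega) hc

lemma fib23 (M : ℕ) (h : 20 ≤ M) : 1000 ≤ Nat.fib (M + 3) :=
  le_trans (by norm_num [Nat.fib_add_two]) (Nat.fib_mono (show 23 ≤ M + 3 by omega))

lemma lower_all (n : ℕ) (hn : 3 * Nat.fib 23 ≤ n) :
    (1 + th) / 3 * n ≤ (minD2 n : ℝ) + 100 := by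
  obtain ⟨M, hM, h1, h2⟩ := bracket n hn
  have hbig := fib23 M hM
  have hu := u_real M
  have f4 : Nat.fib (M + 4) = Nat.fib (M + 2) + Nat.fib (M + 3) := Nat.fib_add_two
  rw [f4] at h2
  generalize hu' : Nat.fib (M + 2) = u at *
  generalize hP : Nat.fib (M + 3) = P at *
  obtain ⟨t, ht⟩ : ∃ t, n = 3 * P + t := ⟨n - 3 * P, by omega⟩
  have hnr : (n : ℝ) = 3 * P + t := by rw [ht]; push_cast; ring
  rw [abs_le] at hu
  obtain ⟨u1, u2⟩ := hu
  have l := th_lb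
  have l2 := th_ub
  have hP0 : (1000 : ℝ) ≤ P := by exact_mod_cast hbig
  have ht0 : (0 : ℝ) ≤ t := by positivity
  have x1 : 0.618 * (P : ℝ) ≤ th * P := by nlinarith
  have x2 : th * (P : ℝ) ≤ 0.6181 * P := by nlinarith
  have y1 : 0.618 * (t : ℝ) ≤ th * t := by nlinarith
  have y2 : th * (t : ℝ) ≤ 0.6181 * t := by nlinarith
  rw [hnr]
  rcases Nat.lt_or_ge P (2 * t) with q1 | q1
  · rcases Nat.lt_or_ge (10 * t) (9 * P) with q2 | q2
    · have a := (lowerF (3 * P + P / 2) (P / 2) M u P hu' hP rfl hbig).2.1 (by omega) (by omega)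
      have b := minD2_mono (3 * P + P / 2) n (by omega)
      have c : 3 * P ≤ minD2 n + u + 40 := by omega
      have c' : (3 : ℝ) * P ≤ minD2 n + u + 40 := by exact_mod_cast c
      have q2' : (10 : ℝ) * t ≤ 9 * P := by exact_mod_cast q2.le
      nlinarith
    · have a := (lowerF (3 * P + (9 * P + 9) / 10) ((9 * P + 9) / 10) M u P hu' hP rfl hbig).2.2
        (by omega) (by omega)
      have b := minD2_mono (3 * P + (9 * P + 9) / 10) n (by omega)
      have c : 2 * P + u ≤ minD2 n + 40 := by omega
      have c' : (2 : ℝ) * P + u ≤ minD2 n + 40 := by exact_mod_cast c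
      have d : t ≤ 3 * u := by omega
      have d' : (t : ℝ) ≤ 3 * u := by exact_mod_cast d
      have e : th * th * P = P - th * P := by have := th_sq; nlinarith
      have e2 : (1 + th) / 3 * (3 * P + t) ≤ (1 + th) * (P + (th * P + 1)) := by
        have : (3 * (P : ℝ) + t) / 3 ≤ P + (th * P + 1) := by linarith
        have h3 : (0 : ℝ) ≤ 1 + th := by linarith
        have := mul_le_mul_of_nonneg_left this h3
        linarith
      have e3 : (1 + th) * (P + (th * P + 1)) = P + 2 * (th * P) + th * th * P + 1 + th := by ring
      rw [e3, e] at e2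
      linarith
  · have a := (lowerF n t M u P hu' hP ht hbig).1 (by omega)
    have c' : (P : ℝ) + u + t ≤ minD2 n + 40 := by exact_mod_cast a
    nlinarith

lemma upper_all (n : ℕ) (hn : 3 * Nat.fib 23 ≤ n) :
    ∃ M : ℕ, (M : ℝ) * M ≤ 2 * n ∧ (minD2 n : ℝ) ≤ (6 - 2 * th) / 7 * n + M + 100 := by
  obtain ⟨M, hM, h1, h2⟩ := bracket n hn
  have hbig := fib23 M hM
  have hu := u_real M
  have hr := ratio M
  have hsq := (sq_le_fib M).1
  have f4 : Nat.fib (M + 4) = Nat.fib (M + 2) + Nat.fib (M + 3) := Nat.fib_add_two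
  rw [f4] at h2
  generalize hu' : Nat.fib (M + 2) = u at *
  generalize hP : Nat.fib (M + 3) = P at *
  obtain ⟨t, ht⟩ : ∃ t, n = 3 * P + t := ⟨n - 3 * P, by omega⟩
  have hnr : (n : ℝ) = 3 * P + t := by rw [ht]; push_cast; ring
  rw [abs_le] at hu
  obtain ⟨u1, u2⟩ := hu
  have l := th_lb
  have l2 := th_ub
  have hP0 : (1000 : ℝ) ≤ P := by exact_mod_cast hbig
  have ht0 : (0 : ℝ) ≤ t := by positivity
  have x1 : 0.618 * (P : ℝ) ≤ th * P := by nlinarith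
  have x2 : th * (P : ℝ) ≤ 0.6181 * P := by nlinarith
  have y1 : 0.618 * (t : ℝ) ≤ th * t := by nlinarith
  have y2 : th * (t : ℝ) ≤ 0.6181 * t := by nlinarith
  have hM0 : (0 : ℝ) ≤ M := by positivity
  refine ⟨M, ?_, ?_⟩
  · have : M * M ≤ 2 * n := by omega
    exact_mod_cast this
  rw [hnr]
  rcases Nat.lt_or_ge P (2 * t) with q1 | q1
  · have q1' : (P : ℝ) ≤ 2 * t := by exact_mod_cast q1.le
    rcases Nat.lt_or_ge (100 * t) (86 * P) with q2 | q2
    · have a := UB n t M u P hu' hP ht (by omega) hbig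
      have q2' : (100 : ℝ) * t ≤ 86 * P := by exact_mod_cast q2.le
      rcases Nat.lt_or_ge t u with q3 | q3
      · have c : minD2 n + u ≤ 3 * P + M + 1 := by omega
        have c' : (minD2 n : ℝ) + u ≤ 3 * P + M + 1 := by exact_mod_cast c
        have k : 0 ≤ (6 - 2 * th) * (t - P / 2) := by
          apply mul_nonneg <;> linarith
        nlinarith
      · have c : minD2 n + 2 * u ≤ 3 * P + t + M + 2 := by omega
        have c' : (minD2 n : ℝ) + 2 * u ≤ 3 * P + t + M + 2 := by exact_mod_cast c
        nlinarith
    · have q2' : (86 : ℝ) * P ≤ 100 * t := by exact_mod_cast q2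
      have a := UA (3 * (u + P)) 0 (M + 1) P (u + P) hP f4 rfl (by omega)
      have b := minD2_mono n (3 * (u + P)) (by omega)
      have c : minD2 n ≤ u + P + P + M + 3 := by omega
      have c' : (minD2 n : ℝ) ≤ u + P + P + M + 3 := by exact_mod_cast c
      nlinarith
  · have q1' : (2 : ℝ) * t ≤ P := by exact_mod_cast q1
    have a := UA n t M u P hu' hP ht (by omega)
    rcases Nat.lt_or_ge (P + t) (2 * u) with q3 | q3
    · have c : minD2 n ≤ P + u + t + M := by omega
      have c' : (minD2 n : ℝ) ≤ P + u + t + M := by exact_mod_cast c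
      nlinarith
    · have c : minD2 n + u ≤ 2 * P + 2 * t + 1 + M := by omega
      have c' : (minD2 n : ℝ) + u ≤ 2 * P + 2 * t + 1 + M := by exact_mod_cast c
      have k : 0 ≤ (8 + 2 * th) * (P / 2 - t) := by
        apply mul_nonneg <;> linarith
      nlinarith

lemma upper_special (M : ℕ) (hM : 20 ≤ M) :
    (minD2 (3 * Nat.fib (M + 3)) : ℝ) ≤ (1 + th) * Nat.fib (M + 3) + M + 100 := by
  have hbig := fib23 M hM
  have hu := u_real M
  have hr := ratio M
  generalize hu' : Nat.fib (M + 2) = u at *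
  generalize hP : Nat.fib (M + 3) = P at *
  have a := UA (3 * P) 0 M u P hu' hP rfl (by omega)
  have c : minD2 (3 * P) ≤ P + u + M := by omega
  have c' : (minD2 (3 * P) : ℝ) ≤ P + u + M := by exact_mod_cast c
  rw [abs_le] at hu
  linarith [hu.1, hu.2]

lemma lower_special (M : ℕ) (hM : 20 ≤ M) :
    (6 - 2 * th) / 7 * ((3 * Nat.fib (M + 3) + Nat.fib (M + 3) / 2 : ℕ) : ℝ) ≤
      (minD2 (3 * Nat.fib (M + 3) + Nat.fib (M + 3) / 2) : ℝ) + 100 := by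
  have hbig := fib23 M hM
  have hu := u_real M
  generalize hu' : Nat.fib (M + 2) = u at *
  generalize hP : Nat.fib (M + 3) = P at *
  have a := (lowerF (3 * P + P / 2) (P / 2) M u P hu' hP rfl hbig).2.1 (by omega) (by omega)
  have c' : (3 : ℝ) * P ≤ minD2 (3 * P + P / 2) + u + 40 := by exact_mod_cast a
  rw [abs_le] at hu
  have h2 : 2 * (3 * P + P / 2) ≤ 7 * P := by omega
  have h2' : (2 : ℝ) * ((3 * P + P / 2 : ℕ) : ℝ) ≤ 7 * P := by exact_mod_cast h2
  have l2 := th_ub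
  have k : 0 ≤ (6 - 2 * th) * (7 * P - 2 * ((3 * P + P / 2 : ℕ) : ℝ)) := by
    apply mul_nonneg <;> linarith
  nlinarith [hu.1, hu.2]


lemma E1 (ε : ℝ) (hε : 0 < ε) :
    ∀ᶠ n : ℕ in Filter.atTop, (1 + th) / 3 - ε ≤ (minD2 n : ℝ) / n := by
  obtain ⟨N, hN⟩ := exists_nat_ge (100 / ε)
  filter_upwards [Filter.eventually_ge_atTop (3 * Nat.fib 23 + N + 1)] with n hn
  have h := lower_all n (by omega)
  have hn0 : (0 : ℝ) < n := by exact_mod_cast (show 0 < n by omega)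
  have hnN : (N : ℝ) ≤ n := by exact_mod_cast (show N ≤ n by omega)
  rw [le_div_iff₀ hn0]
  have : 100 ≤ ε * n := by
    rw [div_le_iff₀ hε] at hN
    nlinarith
  linarith

lemma U1 (ε : ℝ) (hε : 0 < ε) :
    ∀ᶠ n : ℕ in Filter.atTop, (minD2 n : ℝ) / n ≤ (6 - 2 * th) / 7 + ε := by
  obtain ⟨N, hN⟩ := exists_nat_ge ((100 + 1 / ε) / (ε / 2))
  filter_upwards [Filter.eventually_ge_atTop (3 * Nat.fib 23 + N + 1)] with n hn
  obtain ⟨M, h1, h2⟩ := upper_all n (by omega)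
  have hn0 : (0 : ℝ) < n := by exact_mod_cast (show 0 < n by omega)
  have hnN : (N : ℝ) ≤ n := by exact_mod_cast (show N ≤ n by omega)
  rw [div_le_iff₀ hn0]
  have k1 : 100 + 1 / ε ≤ ε / 2 * n := by
    rw [div_le_iff₀ (by positivity)] at hN
    nlinarith
  have k2 : (M : ℝ) ≤ ε / 4 * (M * M) + 1 / ε := by
    have : 0 ≤ ε / 4 * (M - 2 / ε) ^ 2 := by positivity
    have e : ε / 4 * (M - 2 / ε) ^ 2 = ε / 4 * (M * M) - M + 1 / ε := by
      field_simp; ring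
    linarith
  have k3 : ε / 4 * ((M : ℝ) * M) ≤ ε / 4 * (2 * n) :=
    mul_le_mul_of_nonneg_left h1 (by positivity)
  linarith

lemma le_fib3 (M : ℕ) : M ≤ Nat.fib (M + 3) := by
  have := Nat.le_fib_add_one (M + 3)
  omega

lemma E2 (ε : ℝ) (hε : 0 < ε) :
    ∃ᶠ n : ℕ in Filter.atTop, (minD2 n : ℝ) / n ≤ (1 + th) / 3 + ε := by
  rw [Filter.frequently_atTop]
  intro a
  obtain ⟨N, hN⟩ := exists_nat_ge ((100 + 1 / ε) / ε)
  obtain ⟨M, hM⟩ : ∃ M, M = a + N + 20 := ⟨_, rfl⟩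
  have hle := le_fib3 M
  have hup := upper_special M (by omega)
  have hsq := (sq_le_fib M).1
  generalize hP : Nat.fib (M + 3) = P at *
  refine ⟨3 * P, by omega, ?_⟩
  have hP0 : (0 : ℝ) < P := by exact_mod_cast (show 0 < P by omega)
  have hnN : (N : ℝ) ≤ P := by exact_mod_cast (show N ≤ P by omega)
  have hsq' : (M : ℝ) * M ≤ 4 * P := by exact_mod_cast hsq
  have k1 : 100 + 1 / ε ≤ ε * P := by
    rw [div_le_iff₀ (by positivity)] at hN
    nlinarith
  have k2 : (M : ℝ) ≤ ε / 4 * (M * M) + 1 / ε := by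
    have : 0 ≤ ε / 4 * (M - 2 / ε) ^ 2 := by positivity
    have e : ε / 4 * (M - 2 / ε) ^ 2 = ε / 4 * (M * M) - M + 1 / ε := by
      field_simp; ring
    linarith
  have k3 : ε / 4 * ((M : ℝ) * M) ≤ ε / 4 * (4 * P) :=
    mul_le_mul_of_nonneg_left hsq' (by positivity)
  rw [div_le_iff₀ (by push_cast; positivity)]
  push_cast
  nlinarith

lemma U2 (ε : ℝ) (hε : 0 < ε) :
    ∃ᶠ n : ℕ in Filter.atTop, (6 - 2 * th) / 7 - ε ≤ (minD2 n : ℝ) / n := by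
  rw [Filter.frequently_atTop]
  intro a
  obtain ⟨N, hN⟩ := exists_nat_ge (100 / ε)
  obtain ⟨M, hM⟩ : ∃ M, M = a + N + 20 := ⟨_, rfl⟩
  have hle := le_fib3 M
  have hup := lower_special M (by omega)
  generalize hP : Nat.fib (M + 3) = P at *
  obtain ⟨n, hn⟩ : ∃ n, n = 3 * P + P / 2 := ⟨_, rfl⟩
  rw [← hn] at hup
  refine ⟨n, by omega, ?_⟩
  have hn0 : (0 : ℝ) < n := by exact_mod_cast (show 0 < n by omega)
  have hnN : (N : ℝ) ≤ n := by exact_mod_cast (show N ≤ n by omega)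
  rw [le_div_iff₀ hn0]
  have : 100 ≤ ε * n := by
    rw [div_le_iff₀ hε] at hN
    nlinarith
  linarith

/-- With `α = (1+√5)/2`:
`liminf (min_i D(2,i,n))/n = α/3` and `limsup (min_i D(2,i,n))/n = (8-2α)/7`. -/
theorem asymptotics_of_min_squares :
    Filter.liminf (fun n : ℕ => (minD2 n : ℝ) / n) Filter.atTop =
      ((1 + Real.sqrt 5) / 2) / 3 ∧
    Filter.limsup (fun n : ℕ => (minD2 n : ℝ) / n) Filter.atTop =
      (8 - 2 * ((1 + Real.sqrt 5) / 2)) / 7 := by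
  have e1 : ((1 + Real.sqrt 5) / 2) / 3 = (1 + th) / 3 := by unfold th; ring
  have e2 : (8 - 2 * ((1 + Real.sqrt 5) / 2)) / 7 = (6 - 2 * th) / 7 := by unfold th; ring
  rw [e1, e2]
  have bA : Filter.IsBoundedUnder (· ≤ ·) Filter.atTop (fun n : ℕ => (minD2 n : ℝ) / n) :=
    Filter.isBoundedUnder_of_eventually_le (U1 1 one_pos)
  have bB : Filter.IsBoundedUnder (· ≥ ·) Filter.atTop (fun n : ℕ => (minD2 n : ℝ) / n) :=
    Filter.isBoundedUnder_of_eventually_ge (E1 1 one_pos)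
  constructor
  · apply le_antisymm
    · apply le_of_forall_pos_le_add
      intro ε hε
      exact Filter.liminf_le_of_frequently_le (E2 ε hε) bB
    · apply le_of_forall_pos_le_add
      intro ε hε
      have := Filter.le_liminf_of_le bA.isCoboundedUnder_ge (E1 ε hε)
      linarith
  · apply le_antisymm
    · apply le_of_forall_pos_le_add
      intro ε hε
      exact Filter.limsup_le_of_le bB.isCoboundedUnder_le (U1 ε hε)
    · apply le_of_forall_pos_le_add
      intro ε hε
      have := Filter.le_limsup_of_frequently_le (U2 ε hε) bA
      linarith
end
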